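/- arXiv:1311.3193 — 2 statements merged into one kernel-verified Lean document; each statement's English description precedes it below -/
import Mathlib

section
/- Let C be an m-sided Reuleaux polygon of diameter 1 in a not angled two-dimensional real normed plane (i.e., C is an intersection of translates of the unit ball, and m is the least number of translates whose intersection is C). Then m is odd, and writing m = 2s + 1, the k-fold Borsuk number of C is a_k(C) = 2k + ⌈k/s⌉ for every positive integer k. -/
open Set

/-- The `k`-fold Borsuk number of a set `S` in a metric space. -/
noncomputable def borsukNum {X : Type*} [MetricSpace X] (S : Set X) (k : ℕ) : ℕ∞ :=
  sInf {n : ℕ∞ | ∃ m : ℕ, n = (m : ℕ∞) ∧ ∃ F : Fin m → Set X,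
    (∀ i, F i ⊆ S ∧ Metric.diam (F i) < Metric.diam S) ∧
    ∀ x ∈ S, k ≤ {i : Fin m | x ∈ F i}.ncard}

/-- A bounded set is (diametrically) complete if no set of the same diameter
properly contains it. -/
def IsDiamComplete {X : Type*} [MetricSpace X] (C : Set X) : Prop :=
  ¬ ∃ T : Set X, C ⊂ T ∧ Metric.diam T = Metric.diam C

/-- A normed plane is angled if its unit sphere contains two non-collinear
segments `[a,b]` and `[b,c]`. -/
def Angled (E : Type*) [NormedAddCommGroup E] [NormedSpace ℝ E] : Prop :=
  ∃ a b c : E, ¬ Collinear ℝ ({a, b, c} : Set E) ∧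
    segment ℝ a b ∪ segment ℝ b c ⊆ Metric.sphere (0 : E) 1

section NormedPlane

variable {E : Type*} [NormedAddCommGroup E] [NormedSpace ℝ E]

/-- `x` is a convex combination of `a`, `b`, `c`. -/
def InTriangle (x a b c : E) : Prop :=
  ∃ α β γ : ℝ, 0 ≤ α ∧ 0 ≤ β ∧ 0 ≤ γ ∧ α + β + γ = 1 ∧ x = α • a + β • b + γ • c

/-- The segments `[p, q]` and `[r, z]` have a common point. -/
def SegmentsMeet (p q r z : E) : Prop :=
  ∃ s t : ℝ, 0 ≤ s ∧ s ≤ 1 ∧ 0 ≤ t ∧ t ≤ 1 ∧ (1 - s) • p + s • q = (1 - t) • r + t • z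

theorem norm_le_of_eq_add {x u v : E} {a b : ℝ} (h : x = a • u + b • v) (ha : 0 ≤ a)
    (hb : 0 ≤ b) : ‖x‖ ≤ a * ‖u‖ + b * ‖v‖ := by
  rw [h]
  refine (norm_add_le _ _).trans_eq ?_
  rw [norm_smul_of_nonneg ha, norm_smul_of_nonneg hb]

theorem inTriangle_of_affine_dependence {p q r z : E} {a b c d : ℝ} (hs : a + b + c + d = 0)
    (h : a • p + b • q + c • r + d • z = 0) (ha : 0 ≤ a) (hb : 0 ≤ b) (hc : 0 ≤ c) (hd : d < 0) :
    InTriangle z p q r := by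
  have hd' : 0 < -d := by linarith
  refine ⟨a / -d, b / -d, c / -d, by positivity, by positivity, by positivity, ?_, ?_⟩
  · rw [← add_div, ← add_div, div_eq_one_iff_eq hd'.ne']; linarith
  · have : z = (-d)⁻¹ • (-d) • z := by rw [smul_smul, inv_mul_cancel₀ hd'.ne', one_smul]
    rw [this, show (-d) • z = a • p + b • q + c • r by
      linear_combination (norm := module) (-1 : ℝ) • h]
    simp only [smul_add, smul_smul, div_eq_inv_mul]

theorem segmentsMeet_of_affine_dependence {p q r z : E} {a b c d : ℝ} (hs : a + b + c + d = 0)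
    (h : a • p + b • q + c • r + d • z = 0) (ha : 0 ≤ a) (hb : 0 ≤ b) (hc : c ≤ 0) (hd : d ≤ 0)
    (h0 : 0 < a + b) : SegmentsMeet p q r z := by
  have hd' : 0 < -(c + d) := by linarith
  have e : a + b = -(c + d) := by linarith
  refine ⟨b / (a + b), -d / -(c + d), by positivity, (div_le_one h0).2 (by linarith),
    div_nonneg (by linarith) hd'.le, (div_le_one hd').2 (by linarith), ?_⟩
  have e1 : 1 - b / (a + b) = a / (a + b) := by field_simp; ring
  have e2 : 1 - -d / -(c + d) = -c / -(c + d) := by rw [one_sub_div hd'.ne']; ring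
  rw [e1, e2, ← e]
  have : (a + b)⁻¹ • (a • p + b • q) = (a + b)⁻¹ • (-c • r + -d • z) := by
    congr 1
    linear_combination (norm := module) h
  simpa only [smul_add, smul_smul, div_eq_inv_mul] using this

/-- Radon's theorem for four points of a plane, in explicit form. -/
theorem radon_four_points (hdim : Module.finrank ℝ E = 2) (p q r z : E) :
    InTriangle p q r z ∨ InTriangle q p r z ∨ InTriangle r p q z ∨ InTriangle z p q r ∨
      SegmentsMeet p q r z ∨ SegmentsMeet p r q z ∨ SegmentsMeet p z q r := by
  have : FiniteDimensional ℝ E := .of_finrank_pos (by omega)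
  obtain ⟨a, b, c, d, hs, h, h0⟩ : ∃ a b c d : ℝ, a + b + c + d = 0 ∧
      a • p + b • q + c • r + d • z = 0 ∧ ¬ (b = 0 ∧ c = 0 ∧ d = 0) := by
    have hli : ¬ LinearIndependent ℝ ![q - p, r - p, z - p] := fun hli ↦ by
      have := hli.fintype_card_le_finrank
      simp [hdim] at this
    obtain ⟨g, hg, i, hi⟩ := Fintype.not_linearIndependent_iff.1 hli
    simp only [Fin.sum_univ_three, Matrix.cons_val_zero, Matrix.cons_val_one,
      Matrix.cons_val] at hg
    refine ⟨-(g 0 + g 1 + g 2), g 0, g 1, g 2, by ring,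
      by linear_combination (norm := module) hg, fun ⟨h0, h1, h2⟩ ↦ hi ?_⟩
    fin_cases i <;> assumption
  wlog hd : 0 ≤ d generalizing a b c d
  · exact this (-a) (-b) (-c) (-d) (by linarith)
      (by linear_combination (norm := module) (-1 : ℝ) • h) (by simpa using h0) (by linarith)
  have hs' : -a + -b + -c + -d = 0 := by linarith
  have h' : (-a) • p + (-b) • q + (-c) • r + (-d) • z = 0 := by
    linear_combination (norm := module) (-1 : ℝ) • h
  rcases lt_or_ge a 0 with ha | ha <;> rcases lt_or_ge b 0 with hb | hb <;>
    rcases lt_or_ge c 0 with hc | hc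
  · exact .inr <| .inr <| .inr <| .inl <| inTriangle_of_affine_dependence hs' h'
      (by linarith) (by linarith) (by linarith) (by linarith)
  · exact .inr <| .inr <| .inr <| .inr <| .inl <| segmentsMeet_of_affine_dependence hs' h'
      (by linarith) (by linarith) (by linarith) (by linarith) (by linarith)
  · exact .inr <| .inr <| .inr <| .inr <| .inr <| .inl <|
      segmentsMeet_of_affine_dependence (a := -a) (b := -c) (c := -b) (d := -d) (by linarith)
        (by linear_combination (norm := module) h')
        (by linarith) (by linarith) (by linarith) (by linarith) (by linarith)
  · refine .inl <| inTriangle_of_affine_dependence (a := b) (b := c) (c := d) (d := a)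
      (by linarith) (by linear_combination (norm := module) h) hb hc hd ha
  · exact .inr <| .inr <| .inr <| .inr <| .inr <| .inr <|
      segmentsMeet_of_affine_dependence (a := a) (b := d) (c := b) (d := c) (by linarith)
        (by linear_combination (norm := module) h)
        (by linarith) (by linarith) (by linarith) (by linarith) (by linarith)
  · exact .inr <| .inl <| inTriangle_of_affine_dependence (a := a) (b := c) (c := d) (d := b)
      (by linarith) (by linear_combination (norm := module) h) ha hc hd hb
  · exact .inr <| .inr <| .inl <|
      inTriangle_of_affine_dependence (a := a) (b := b) (c := d) (d := c)
      (by linarith) (by linear_combination (norm := module) h) ha hb hd hc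
  · exact absurd ⟨by linarith, by linarith, by linarith⟩ h0

/-- If a convex combination of three points is at distance one from the first of them, and all the
distances are at most one, then the first point has coefficient zero. -/
theorem coeff_eq_zero_of_norm_sub_eq_one {x a b c : E} {α β γ : ℝ} (hβ : 0 ≤ β) (hγ : 0 ≤ γ)
    (hα : 0 ≤ α) (hs : α + β + γ = 1) (hx : x = α • a + β • b + γ • c) (hxa : ‖x - a‖ = 1)
    (hba : ‖b - a‖ ≤ 1) (hca : ‖c - a‖ ≤ 1) : α = 0 := by
  have := norm_le_of_eq_add (x := x - a) (u := b - a) (v := c - a) (a := β) (b := γ)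
    (by subst hx; obtain rfl : α = 1 - β - γ := by linarith
        module) hβ hγ
  nlinarith

theorem InTriangle.swap₁₃ {x a b c : E} (h : InTriangle x a b c) : InTriangle x c b a := by
  obtain ⟨α, β, γ, hα, hβ, hγ, hs, h⟩ := h
  exact ⟨γ, β, α, hγ, hβ, hα, by linarith, by rw [h]; module⟩

/-- A point of a triangle of diameter at most one which is at distance one from two vertices
is the third vertex. -/
theorem InTriangle.eq_of_norm_sub_eq_one {x a b c : E} (h : InTriangle x a b c)
    (hxa : ‖x - a‖ = 1) (hxb : ‖x - b‖ = 1) (hab : ‖a - b‖ ≤ 1) (hac : ‖a - c‖ ≤ 1)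
    (hbc : ‖b - c‖ ≤ 1) : x = c := by
  obtain ⟨α, β, γ, hα, hβ, hγ, hs, h⟩ := h
  have h1 := coeff_eq_zero_of_norm_sub_eq_one hβ hγ hα hs h hxa (by rwa [norm_sub_rev])
    (by rwa [norm_sub_rev])
  have h2 := coeff_eq_zero_of_norm_sub_eq_one (x := x) (a := b) (b := a) (c := c) hα hγ hβ
    (by linarith) (by rw [h, add_comm (α • a)]) hxb hab (by rwa [norm_sub_rev])
  obtain rfl : γ = 1 := by linarith
  simp [h, h1, h2]

/-- Opposite sides of a quadrilateral are in total not longer than the diagonals. -/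
theorem SegmentsMeet.norm_add_norm_le {p q r z : E} (h : SegmentsMeet p q r z) :
    ‖p - r‖ + ‖q - z‖ ≤ ‖p - q‖ + ‖r - z‖ := by
  obtain ⟨s, t, hs0, hs1, ht0, ht1, h⟩ := h
  have h1 := norm_le_of_eq_add (x := p - r) (u := p - q) (v := z - r) (a := s) (b := t)
    (by linear_combination (norm := module) h) hs0 ht0
  have h2 := norm_le_of_eq_add (x := q - z) (u := q - p) (v := r - z) (a := 1 - s) (b := 1 - t)
    (by linear_combination (norm := module) h) (by linarith) (by linarith)
  rw [norm_sub_rev z r] at h1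
  rw [norm_sub_rev q p] at h2
  linarith

theorem SegmentsMeet.swap_right {p q r z : E} (h : SegmentsMeet p q r z) :
    SegmentsMeet p q z r := by
  obtain ⟨s, t, hs0, hs1, ht0, ht1, h⟩ := h
  exact ⟨s, 1 - t, hs0, hs1, by linarith, by linarith, by rw [h, sub_sub_cancel, add_comm]⟩

/-- In a norm which is not angled, segments of a unit sphere with a common endpoint
are collinear. -/
theorem collinear_of_norm_midpoint (hang : ¬ Angled E) {a b c : E} (ha : ‖a‖ = 1)
    (hb : ‖b‖ = 1) (hc : ‖c‖ = 1) (hab : ‖a + b‖ = 2) (hbc : ‖b + c‖ = 2) :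
    Collinear ℝ ({a, b, c} : Set E) := by
  have key : ∀ a b : E, ‖a‖ = 1 → ‖b‖ = 1 → ‖a + b‖ = 2 →
      segment ℝ a b ⊆ Metric.sphere (0 : E) 1 := by
    rintro a b ha hb hab x ⟨s, t, hs, ht, hst, rfl⟩
    have h1 := norm_le_of_eq_add (x := s • a + t • b) rfl hs ht
    have h2 := norm_le_of_eq_add (x := t • a + s • b) rfl ht hs
    have h3 := norm_add_le (s • a + t • b) (t • a + s • b)
    rw [show s • a + t • b + (t • a + s • b) = a + b by
      obtain rfl : t = 1 - s := by linarith
      module, hab] at h3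
    rw [ha, hb] at h1 h2
    rw [mem_sphere_zero_iff_norm]
    linarith
  by_contra h
  exact hang ⟨a, b, c, h, union_subset (key a b ha hb hab) (key b c hb hc hbc)⟩

theorem not_four_equidistant (hdim : Module.finrank ℝ E = 2) (hang : ¬ Angled E) {p q r z : E}
    (hpq : ‖p - q‖ = 1) (hpr : ‖p - r‖ = 1) (hpz : ‖p - z‖ = 1) (hqr : ‖q - r‖ = 1)
    (hqz : ‖q - z‖ = 1) (hrz : ‖r - z‖ = 1) : False := by
  have tri : ∀ {x a b c : E}, InTriangle x a b c → ‖x - a‖ = 1 → ‖x - b‖ = 1 → ‖x - c‖ = 1 →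
      ‖a - b‖ = 1 → ‖a - c‖ = 1 → ‖b - c‖ = 1 → False := by
    intro x a b c h h1 h2 h3 h4 h5 h6
    have := h.eq_of_norm_sub_eq_one h1 h2 h4.le h5.le h6.le
    simp [this] at h3
  have meet : ∀ {p q r z : E}, SegmentsMeet p r q z → ‖p - q‖ = 1 → ‖p - r‖ = 1 → ‖p - z‖ = 1 →
      ‖q - r‖ = 1 → ‖q - z‖ = 1 → ‖r - z‖ = 1 → False := by
    rintro p q r z ⟨s, t, hs0, hs1, ht0, ht1, h⟩ hpq hpr hpz hqr hqz hrz
    have h1 := norm_le_of_eq_add (x := p - z) (u := p - r) (v := q - z) (a := s) (b := 1 - t)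
      (by linear_combination (norm := module) h) hs0 (by linarith)
    have h2 := norm_le_of_eq_add (x := q - r) (u := p - r) (v := q - z) (a := 1 - s) (b := t)
      (by linear_combination (norm := module) (-1 : ℝ) • h) (by linarith) ht0
    have h3 := norm_le_of_eq_add (x := p - q) (u := p - r) (v := z - q) (a := s) (b := t)
      (by linear_combination (norm := module) h) hs0 ht0
    have h4 := norm_le_of_eq_add (x := r - z) (u := r - p) (v := q - z) (a := 1 - s) (b := 1 - t)
      (by linear_combination (norm := module) h) (by linarith) (by linarith)
    rw [norm_sub_rev z q] at h3
    rw [norm_sub_rev r p] at h4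
    rw [hpr, hqz] at h1 h2 h3 h4
    obtain rfl : s = t := by linarith
    obtain rfl : s = 1 / 2 := by linarith
    have e1 : ‖(p - r) + (q - z)‖ = 2 := by
      rw [show (p - r) + (q - z) = (2 : ℝ) • (p - z) by
        linear_combination (norm := module) (-2 : ℝ) • h, norm_smul, hpz]
      norm_num
    have e2 : ‖(p - r) + (z - q)‖ = 2 := by
      rw [show (p - r) + (z - q) = (2 : ℝ) • (p - q) by
        linear_combination (norm := module) (-2 : ℝ) • h, norm_smul, hpq]
      norm_num
    have hcol := collinear_of_norm_midpoint hang hqz hpr (by rwa [norm_sub_rev])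
      (by rwa [add_comm]) e2
    obtain ⟨x, hx⟩ := (collinear_iff_of_mem (p₀ := q - z) (by simp)).1 hcol
    obtain ⟨a, ha⟩ := hx (p - r) (by simp)
    obtain ⟨b, hb⟩ := hx (z - q) (by simp)
    simp only [vadd_eq_add] at ha hb
    have hb0 : b ≠ 0 := by
      rintro rfl
      have : (2 : ℝ) • (q - z) = 0 := by linear_combination (norm := module) (-1 : ℝ) • hb
      simp only [smul_eq_zero, OfNat.ofNat_ne_zero, false_or] at this
      simp [this] at hqz
    have hpr' : p - r = (1 - 2 * (a / b)) • (q - z) := by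
      have : x = (-2 / b) • (q - z) := by
        have : b • x = (-2 : ℝ) • (q - z) := by linear_combination (norm := module) (-1 : ℝ) • hb
        rw [div_eq_inv_mul, mul_smul, ← this, smul_smul, inv_mul_cancel₀ hb0, one_smul]
      rw [ha, this, smul_smul]
      module
    rw [hpr', show (1 - 2 * (a / b)) • (q - z) + (q - z) = (2 - 2 * (a / b)) • (q - z) by module,
      norm_smul, hqz, mul_one, Real.norm_eq_abs] at e1
    rw [hpr', show (1 - 2 * (a / b)) • (q - z) + (z - q) = (- 2 * (a / b)) • (q - z) by module,
      norm_smul, hqz, mul_one, Real.norm_eq_abs] at e2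
    rw [hpr', norm_smul, hqz, mul_one, Real.norm_eq_abs] at hpr
    rcases abs_cases (1 - 2 * (a / b)) with h5 | h5 <;>
      rcases abs_cases (2 - 2 * (a / b)) with h6 | h6 <;>
      rcases abs_cases (-2 * (a / b)) with h7 | h7 <;> linarith
  rcases radon_four_points hdim p q r z with h | h | h | h | h | h | h
  · exact tri h hpq hpr hpz hqr hqz hrz
  · exact tri h (by rwa [norm_sub_rev]) hqr hqz hpr hpz hrz
  · exact tri h (by rwa [norm_sub_rev]) (by rwa [norm_sub_rev]) hrz hpq hpz hqz
  · exact tri h (by rwa [norm_sub_rev]) (by rwa [norm_sub_rev]) (by rwa [norm_sub_rev]) hpq hpr hqr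
  · exact meet h hpr hpq hpz (by rwa [norm_sub_rev]) hrz hqz
  · exact meet h hpq hpr hpz hqr hqz hrz
  · exact meet h hpq hpz hpr hqz hqr (by rwa [norm_sub_rev])

/-- In a plane which is not angled, two pairs of points with all four mutual distances equal to one
lie on two parallel supporting lines of a set of diameter one. -/
theorem exists_common_functional (hdim : Module.finrank ℝ E = 2) (hang : ¬ Angled E) {p q a b : E}
    (hpa : ‖p - a‖ = 1) (hpb : ‖p - b‖ = 1) (hqa : ‖q - a‖ = 1) (hqb : ‖q - b‖ = 1)
    (hpq : ‖p - q‖ ≤ 1) (hab : ‖a - b‖ ≤ 1) (hpq' : p ≠ q) (hab' : a ≠ b) :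
    ∃ h : StrongDual ℝ E, ‖h‖ ≤ 1 ∧ h (p - a) = 1 ∧ h (p - b) = 1 ∧ h (q - a) = 1 ∧
      h (q - b) = 1 := by
  have key : ∀ {p q a b : E}, ‖p - a‖ = 1 → ‖p - b‖ = 1 → ‖q - a‖ = 1 → ‖q - b‖ = 1 → p ≠ q →
      a ≠ b → SegmentsMeet p a q b → ∃ h : StrongDual ℝ E, ‖h‖ ≤ 1 ∧ h (p - a) = 1 ∧
      h (p - b) = 1 ∧ h (q - a) = 1 ∧ h (q - b) = 1 := by
    rintro p q a b hpa hpb hqa hqb hpq' hab' ⟨s, t, hs0, hs1, ht0, ht1, h⟩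
    have h1 := norm_le_of_eq_add (x := p - b) (u := p - a) (v := q - b) (a := s) (b := 1 - t)
      (by linear_combination (norm := module) h) hs0 (by linarith)
    have h2 := norm_le_of_eq_add (x := q - a) (u := p - a) (v := q - b) (a := 1 - s) (b := t)
      (by linear_combination (norm := module) (-1 : ℝ) • h) (by linarith) ht0
    rw [hpa, hqb] at h1 h2
    obtain rfl : s = t := by linarith
    have hs0' : 0 < s := hs0.lt_of_ne (by rintro rfl; simp at h; exact hpq' h)
    have hs1' : s < 1 := hs1.lt_of_ne (by rintro rfl; simp at h; exact hab' h)
    obtain ⟨g, hg, hgx⟩ := exists_dual_vector'' ℝ (p - b)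
    have hle : ∀ x : E, ‖x‖ = 1 → g x ≤ 1 := fun x hx ↦
      (le_abs_self _).trans <| (g.le_of_opNorm_le hg x).trans (by simp [hx])
    have e : p - b = s • (p - a) + (1 - s) • (q - b) := by
      linear_combination (norm := module) h
    have e' : q - a = (1 - s) • (p - a) + s • (q - b) := by
      linear_combination (norm := module) (-1 : ℝ) • h
    rw [hpb] at hgx
    simp only [RCLike.ofReal_real_eq_id, id_eq] at hgx
    have e1 := congrArg g e
    have e2 := congrArg g e'
    rw [map_add, map_smul, map_smul, smul_eq_mul, smul_eq_mul] at e1 e2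
    have l1 := hle _ hpa
    have l2 := hle _ hqb
    have v1 : g (p - a) = 1 := by nlinarith
    have v2 : g (q - b) = 1 := by nlinarith
    exact ⟨g, hg, v1, hgx, by rw [e2, v1, v2]; ring, v2⟩
  rcases radon_four_points hdim p q a b with h | h | h | h | h | h | h
  · exact absurd (h.swap₁₃.eq_of_norm_sub_eq_one hpb hpa (by rwa [norm_sub_rev])
      (by rw [norm_sub_rev, hqb]) (by rw [norm_sub_rev, hqa])) hpq'
  · exact absurd (h.swap₁₃.eq_of_norm_sub_eq_one hqb hqa (by rwa [norm_sub_rev])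
      (by rw [norm_sub_rev, hpb]) (by rw [norm_sub_rev, hpa])).symm hpq'
  · exact absurd (h.eq_of_norm_sub_eq_one (by rwa [norm_sub_rev]) (by rwa [norm_sub_rev]) hpq
      hpb.le hqb.le) hab'
  · exact absurd (h.eq_of_norm_sub_eq_one (by rwa [norm_sub_rev]) (by rwa [norm_sub_rev]) hpq
      hpa.le hqa.le).symm hab'
  · have := h.norm_add_norm_le
    exact (not_four_equidistant hdim hang (by linarith) hpa hpb hqa hqb (by linarith)).elim
  · exact key hpa hpb hqa hqb hpq' hab' h
  · obtain ⟨g, hg, h1, h2, h3, h4⟩ := key hpb hpa hqb hqa hpq' hab'.symm h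
    exact ⟨g, hg, h2, h1, h4, h3⟩

/-- Two unit segments in a set of diameter one, one of which lies strictly on one side of the line
spanned by the other. -/
theorem norm_sub_eq_one_of_same_side (hdim : Module.finrank ℝ E = 2) {p q r z : E}
    {l : E →ₗ[ℝ] ℝ} (hpq : ‖p - q‖ = 1) (hrz : ‖r - z‖ = 1) (hpr : ‖p - r‖ ≤ 1)
    (hpz : ‖p - z‖ ≤ 1) (hqr : ‖q - r‖ ≤ 1) (hqz : ‖q - z‖ ≤ 1) (hl : l p = l q)
    (hside : 0 < (l r - l p) * (l z - l p)) :
    (‖p - r‖ = 1 ∧ ‖q - z‖ = 1) ∨ (‖p - z‖ = 1 ∧ ‖q - r‖ = 1) := by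
  wlog hr : 0 < l r - l p generalizing l
  · refine this (l := -l) (by simp [hl]) ?_ ?_
    · simp only [LinearMap.neg_apply]; linarith
    · simp only [LinearMap.neg_apply]
      have : l r - l p ≠ 0 := fun h ↦ by simp [h] at hside
      have := lt_of_le_of_ne (not_lt.1 hr) this
      linarith
  have hz : 0 < l z - l p := by
    by_contra! h
    nlinarith
  have hpos : ∀ γ : ℝ, 0 ≤ γ → 0 ≤ 1 - γ → 0 < (1 - γ) * (l r - l p) + γ * (l z - l p) := by
    intro γ h0 h1
    rcases h0.eq_or_lt with rfl | h0
    · simpa using hr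
    · exact add_pos_of_nonneg_of_pos (mul_nonneg h1 hr.le) (mul_pos h0 hz)
  rcases radon_four_points hdim p q r z with h | h | h | h | h | h | h
  · obtain ⟨α, β, γ, hα, hβ, hγ, hs, h⟩ := h
    have h0 := coeff_eq_zero_of_norm_sub_eq_one hβ hγ hα hs h hpq (by rwa [norm_sub_rev])
      (by rwa [norm_sub_rev])
    have := congrArg l h
    simp only [map_add, map_smul, smul_eq_mul] at this
    obtain rfl : β = 1 - γ := by linarith
    subst h0
    linarith [hpos γ hγ hβ]
  · obtain ⟨α, β, γ, hα, hβ, hγ, hs, h⟩ := h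
    have h0 := coeff_eq_zero_of_norm_sub_eq_one hβ hγ hα hs h (by rwa [norm_sub_rev])
      (by rwa [norm_sub_rev]) (by rwa [norm_sub_rev])
    have := congrArg l h
    simp only [map_add, map_smul, smul_eq_mul] at this
    obtain rfl : β = 1 - γ := by linarith
    subst h0
    linarith [hpos γ hγ hβ]
  · obtain ⟨α, β, γ, hα, hβ, hγ, hs, h⟩ := h.swap₁₃
    have h0 := coeff_eq_zero_of_norm_sub_eq_one hβ hγ hα hs h hrz hqz hpz
    have := congrArg l h
    simp only [map_add, map_smul, smul_eq_mul] at this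
    obtain rfl : β = 1 - γ := by linarith
    subst h0
    nlinarith
  · obtain ⟨α, β, γ, hα, hβ, hγ, hs, h⟩ := h.swap₁₃
    have h0 := coeff_eq_zero_of_norm_sub_eq_one hβ hγ hα hs h (by rwa [norm_sub_rev]) hqr hpr
    have := congrArg l h
    simp only [map_add, map_smul, smul_eq_mul] at this
    obtain rfl : β = 1 - γ := by linarith
    subst h0
    nlinarith
  · obtain ⟨s, t, hs0, hs1, ht0, ht1, h⟩ := h
    have := congrArg l h
    simp only [map_add, map_smul, smul_eq_mul, ← hl] at this
    linarith [hpos t ht0 (by linarith)]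
  · have := h.norm_add_norm_le
    exact .inl ⟨by linarith, by linarith⟩
  · have := h.swap_right.norm_add_norm_le
    have := h.norm_add_norm_le
    rw [norm_sub_rev z r] at *
    exact .inr ⟨by linarith, by linarith⟩

theorem norm_sub_eq_one_of_opposite_sides (hdim : Module.finrank ℝ E = 2) {a b c d : E}
    {l : E →ₗ[ℝ] ℝ} (hab : ‖a - b‖ = 1) (hbc : ‖b - c‖ = 1) (hcd : ‖c - d‖ = 1)
    (hac : ‖a - c‖ ≤ 1) (had : ‖a - d‖ ≤ 1) (hbd : ‖b - d‖ ≤ 1) (hl : l b = l c)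
    (hside : (l a - l b) * (l d - l b) < 0) : ‖a - d‖ = 1 := by
  have hne : b ≠ c := by rintro rfl; simp at hbc
  wlog hr : l a - l b < 0 generalizing l
  · refine this (l := -l) (by simp [hl]) ?_ ?_
    · simp only [LinearMap.neg_apply]; linarith
    · simp only [LinearMap.neg_apply]
      have : l a - l b ≠ 0 := fun h ↦ by simp [h] at hside
      have := lt_of_le_of_ne (not_lt.1 hr) this.symm
      linarith
  have hz : 0 < l d - l b := by
    by_contra! h
    nlinarith
  rcases radon_four_points hdim a b c d with h | h | h | h | h | h | h
  · obtain ⟨α, β, γ, hα, hβ, hγ, hs, h⟩ := h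
    have := congrArg l h
    simp only [map_add, map_smul, smul_eq_mul] at this
    obtain rfl : β = 1 - α - γ := by linarith
    nlinarith
  · obtain ⟨α, β, γ, hα, hβ, hγ, hs, h⟩ := h
    have h0 := coeff_eq_zero_of_norm_sub_eq_one hβ hγ hα hs h (by rwa [norm_sub_rev])
      (by rwa [norm_sub_rev]) (by rwa [norm_sub_rev])
    have := congrArg l h
    simp only [map_add, map_smul, smul_eq_mul] at this
    obtain rfl : β = 1 - γ := by linarith
    subst h0
    have hγ0 : γ = 0 := by nlinarith
    subst hγ0
    simp at h
    exact absurd h hne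
  · obtain ⟨α, β, γ, hα, hβ, hγ, hs, h⟩ := h.swap₁₃
    have h0 := coeff_eq_zero_of_norm_sub_eq_one hβ hγ hα hs h hcd hbd had
    have := congrArg l h
    simp only [map_add, map_smul, smul_eq_mul] at this
    obtain rfl : β = 1 - γ := by linarith
    subst h0
    have hγ0 : γ = 0 := by nlinarith
    subst hγ0
    simp at h
    exact absurd h.symm hne
  · obtain ⟨α, β, γ, hα, hβ, hγ, hs, h⟩ := h
    have := congrArg l h
    simp only [map_add, map_smul, smul_eq_mul] at this
    obtain rfl : γ = 1 - α - β := by linarith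
    nlinarith
  · obtain ⟨s, t, hs0, hs1, ht0, ht1, h⟩ := h
    have := congrArg l h
    simp only [map_add, map_smul, smul_eq_mul] at this
    have h1 : s = 1 := by nlinarith
    have h2 : t = 0 := by subst h1; nlinarith
    subst h1 h2
    simp at h
    exact absurd h hne
  · obtain ⟨s, t, hs0, hs1, ht0, ht1, h⟩ := h
    have := congrArg l h
    simp only [map_add, map_smul, smul_eq_mul] at this
    have h1 : s = 1 := by nlinarith
    have h2 : t = 0 := by subst h1; nlinarith
    subst h1 h2
    simp at h
    exact absurd h.symm hne
  · have := h.norm_add_norm_le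
    rw [norm_sub_rev d c] at this
    linarith

/-- A point on the line through two points at distance one. -/
theorem eq_or_eq_or_norm_sub_eq_one (hdim : Module.finrank ℝ E = 2) {p q r z : E}
    {l : E →ₗ[ℝ] ℝ} (hl0 : l ≠ 0) (hpq : ‖p - q‖ = 1) (hrz : ‖r - z‖ = 1) (hpr : ‖p - r‖ ≤ 1)
    (hqr : ‖q - r‖ ≤ 1) (hpz : ‖p - z‖ ≤ 1) (hqz : ‖q - z‖ ≤ 1) (hl : l p = l q)
    (hr : l r = l p) : r = p ∨ r = q ∨ (‖p - z‖ = 1 ∧ ‖q - z‖ = 1) := by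
  have : FiniteDimensional ℝ E := .of_finrank_pos (by omega)
  have hker : Module.finrank ℝ (LinearMap.ker l) = 1 := by
    have := Module.Dual.finrank_ker_add_one_of_ne_zero hl0
    omega
  have hne : q - p ≠ 0 := fun h ↦ by
    rw [norm_sub_rev, h] at hpq; simp at hpq
  obtain ⟨τ, hτ⟩ := (finrank_eq_one_iff_of_nonzero' (⟨q - p, by simp [hl]⟩ : LinearMap.ker l)
    (by simpa using hne)).1 hker ⟨r - p, by simp [hr]⟩
  have hτ' : τ • (q - p) = r - p := congrArg Subtype.val hτ
  have n1 : ‖p - r‖ = |τ| := by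
    rw [norm_sub_rev, ← hτ', norm_smul, norm_sub_rev q p, hpq, mul_one, Real.norm_eq_abs]
  have n2 : ‖q - r‖ = |1 - τ| := by
    rw [show q - r = (1 - τ) • (q - p) by linear_combination (norm := module) hτ', norm_smul,
      norm_sub_rev q p, hpq, mul_one, Real.norm_eq_abs]
  rw [n1, abs_le] at hpr
  rw [n2, abs_le] at hqr
  have h := norm_le_of_eq_add (x := r - z) (u := p - z) (v := q - z) (a := 1 - τ) (b := τ)
    (by linear_combination (norm := module) (-1 : ℝ) • hτ') (by linarith) (by linarith)
  by_cases h0 : τ = 0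
  · left; subst h0; simpa [eq_comm, sub_eq_zero] using hτ'
  by_cases h1 : τ = 1
  · right; left; subst h1; simpa [eq_comm] using hτ'
  have h0' : 0 < τ := lt_of_le_of_ne (by linarith) (Ne.symm h0)
  have h1' : 0 < 1 - τ := lt_of_le_of_ne (by linarith) (fun h ↦ h1 (by linarith))
  right; right
  constructor <;> nlinarith

theorem exists_functional_eq (hdim : Module.finrank ℝ E = 2) (x : E) :
    ∃ l : E →ₗ[ℝ] ℝ, l ≠ 0 ∧ l x = 0 := by
  have : FiniteDimensional ℝ E := .of_finrank_pos (by omega)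
  obtain ⟨f, hf, hfx⟩ := Submodule.exists_dual_map_eq_bot_of_lt_top
    (p := Submodule.span ℝ {x}) (lt_top_iff_ne_top.2 fun h ↦ by
      have := finrank_span_le_card (R := ℝ) ({x} : Set E)
      rw [h, finrank_top, hdim] at this
      simp at this) inferInstance
  refine ⟨f, hf, ?_⟩
  have : f x ∈ (Submodule.span ℝ {x}).map f :=
    Submodule.mem_map_of_mem (Submodule.mem_span_singleton_self x)
  rw [hfx] at this
  simpa using this

theorem norm_sub_eq_one_symm {F : Type*} [NormedAddCommGroup F] {x y : F} (h : ‖x - y‖ = 1) :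
    ‖y - x‖ = 1 := by
  rwa [norm_sub_rev]

theorem ne_of_norm_sub_eq_one {F : Type*} [NormedAddCommGroup F] {x y : F} (h : ‖x - y‖ = 1) :
    x ≠ y := by
  rintro rfl
  simp at h

theorem StrongDual.le_norm {f : StrongDual ℝ E} (hf : ‖f‖ ≤ 1) (u : E) : f u ≤ ‖u‖ :=
  (le_abs_self _).trans ((f.le_of_opNorm_le hf u).trans_eq (one_mul _))

theorem norm_add_eq_two_of_apply_eq_one {h : StrongDual ℝ E} (hn : ‖h‖ ≤ 1) {a b : E}
    (ha : ‖a‖ = 1) (hb : ‖b‖ = 1) (h1 : h a = 1) (h2 : h b = 1) : ‖a + b‖ = 2 := by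
  refine le_antisymm ((norm_add_le _ _).trans_eq (by rw [ha, hb]; norm_num)) ?_
  have := StrongDual.le_norm hn (a + b)
  rw [map_add, h1, h2] at this
  linarith

theorem apply_eq_one_of_collinear {h : StrongDual ℝ E} {a b c : E}
    (hcol : Collinear ℝ {a, b, c}) (h1 : h a = 1) (h2 : h b = 1) (hab : a ≠ b) : h c = 1 := by
  obtain ⟨v, hv⟩ := (collinear_iff_of_mem (p₀ := a) (by simp)).1 hcol
  obtain ⟨α, hα⟩ := hv b (by simp)
  obtain ⟨β, hβ⟩ := hv c (by simp)
  simp only [vadd_eq_add] at hα hβ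
  have hα' := congrArg h hα
  rw [map_add, map_smul, h1, h2, smul_eq_mul] at hα'
  have hα0 : α ≠ 0 := by
    rintro rfl
    simp [hα] at hab
  have hv0 : h v = 0 := by
    have : α * h v = 0 := by linarith
    exact (mul_eq_zero.1 this).resolve_left hα0
  rw [hβ, map_add, map_smul, hv0, h1, smul_zero, zero_add]

/-- A closed walk of length six in the unit distance graph has a chord. -/
theorem exists_chord_of_six_cycle (hdim : Module.finrank ℝ E = 2) {C : Set E}
    (hC : ∀ u ∈ C, ∀ v ∈ C, ‖u - v‖ ≤ 1) {a b c d y x : E} (ha : a ∈ C) (hb : b ∈ C)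
    (hc : c ∈ C) (hd : d ∈ C) (hy : y ∈ C) (hx : x ∈ C) (hab : ‖a - b‖ = 1) (hbc : ‖b - c‖ = 1)
    (hcd : ‖c - d‖ = 1) (hdy : ‖d - y‖ = 1) (hyx : ‖y - x‖ = 1) (hxa : ‖x - a‖ = 1) :
    (‖a - d‖ = 1 ∨ ‖b - y‖ = 1 ∨ ‖c - x‖ = 1) ∨ ‖a - c‖ = 1 ∨ ‖b - d‖ = 1 ∨ ‖c - y‖ = 1 ∨
      ‖d - x‖ = 1 ∨ ‖y - a‖ = 1 ∨ ‖x - b‖ = 1 := by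
  obtain ⟨l, hl0, hl⟩ := exists_functional_eq hdim (b - c)
  rw [map_sub, sub_eq_zero] at hl
  have sym : ∀ {u v : E}, ‖u - v‖ = 1 → ‖v - u‖ = 1 := norm_sub_eq_one_symm
  have Z : ∀ {r z : E}, r ∈ C → z ∈ C → ‖r - z‖ = 1 → l r = l b →
      r = b ∨ r = c ∨ (‖b - z‖ = 1 ∧ ‖c - z‖ = 1) := fun {r z} hr hz hrz h ↦
    eq_or_eq_or_norm_sub_eq_one hdim hl0 hbc hrz (hC _ hb _ hr) (hC _ hc _ hr) (hC _ hb _ hz)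
      (hC _ hc _ hz) hl h
  have X : ∀ {r z : E}, r ∈ C → z ∈ C → ‖r - z‖ = 1 → 0 < (l r - l b) * (l z - l b) →
      (‖b - r‖ = 1 ∧ ‖c - z‖ = 1) ∨ (‖b - z‖ = 1 ∧ ‖c - r‖ = 1) := fun {r z} hr hz hrz h ↦
    norm_sub_eq_one_of_same_side hdim hbc hrz (hC _ hb _ hr) (hC _ hb _ hz) (hC _ hc _ hr)
      (hC _ hc _ hz) hl h
  by_contra! hcon
  obtain ⟨⟨n1, n2, n3⟩, n4, n5, n6, n7, n8, n9⟩ := hcon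
  have hla : l a - l b ≠ 0 := by
    intro h
    rcases Z ha hx (sym hxa) (sub_eq_zero.1 h) with rfl | rfl | h
    · simp at hab
    · exact n1 hcd
    · exact n9 (sym h.1)
  have hld : l d - l b ≠ 0 := by
    intro h
    rcases Z hd hy hdy (sub_eq_zero.1 h) with rfl | rfl | h
    · exact n1 hab
    · simp at hcd
    · exact n2 h.1
  have hly : l y - l b ≠ 0 := by
    intro h
    rcases Z hy hd (sym hdy) (sub_eq_zero.1 h) with rfl | rfl | h
    · exact n9 (sym hyx)
    · exact n3 hyx
    · exact n5 h.1
  have hlx : l x - l b ≠ 0 := by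
    intro h
    rcases Z hx ha hxa (sub_eq_zero.1 h) with rfl | rfl | h
    · exact n2 (sym hyx)
    · exact n6 (sym hyx)
    · exact n4 (sym h.2)
  have s1 : 0 < (l a - l b) * (l d - l b) := by
    refine lt_of_le_of_ne (not_lt.1 fun h ↦ n1 ?_) (mul_ne_zero hla hld).symm
    exact norm_sub_eq_one_of_opposite_sides hdim hab hbc hcd (hC _ ha _ hc) (hC _ ha _ hd)
      (hC _ hb _ hd) hl h
  have s2 : (l d - l b) * (l y - l b) < 0 := by
    refine lt_of_le_of_ne (not_lt.1 fun h ↦ ?_) (mul_ne_zero hld hly)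
    rcases X hd hy hdy h with h | h
    exacts [n5 h.1, n2 h.1]
  have s3 : (l y - l b) * (l x - l b) < 0 := by
    refine lt_of_le_of_ne (not_lt.1 fun h ↦ ?_) (mul_ne_zero hly hlx)
    rcases X hy hx hyx h with h | h
    exacts [n2 h.1, n6 h.2]
  have s4 : (l x - l b) * (l a - l b) < 0 := by
    refine lt_of_le_of_ne (not_lt.1 fun h ↦ ?_) (mul_ne_zero hlx hla)
    rcases X hx ha hxa h with h | h
    exacts [n9 (sym h.1), n3 h.2]
  have t1 := mul_pos s1 (mul_pos_of_neg_of_neg s2 s3)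
  have t2 := mul_neg_of_pos_of_neg t1 s4
  nlinarith [mul_nonneg (mul_nonneg (sq_nonneg (l a - l b)) (sq_nonneg (l d - l b)))
    (mul_nonneg (sq_nonneg (l y - l b)) (sq_nonneg (l x - l b)))]

/-- In a hexagon of unit distances, a long chord forces the crossing long chord. -/
theorem norm_sub_eq_one_of_six_cycle (hdim : Module.finrank ℝ E = 2) (hang : ¬ Angled E)
    {C : Set E} (hC : ∀ u ∈ C, ∀ v ∈ C, ‖u - v‖ ≤ 1) {a b c d y x : E} (ha : a ∈ C) (hb : b ∈ C)
    (hc : c ∈ C) (hd : d ∈ C) (hy : y ∈ C) (hx : x ∈ C) (hab : ‖a - b‖ = 1) (hbc : ‖b - c‖ = 1)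
    (hcd : ‖c - d‖ = 1) (hdy : ‖d - y‖ = 1) (hyx : ‖y - x‖ = 1) (hxa : ‖x - a‖ = 1)
    (hxc : ‖x - c‖ = 1) (hac : a ≠ c) (hxd : x ≠ d) : ‖b - y‖ = 1 := by
  rcases eq_or_ne x b with rfl | hxb
  · exact norm_sub_eq_one_symm hyx
  rcases eq_or_ne y c with rfl | hyc
  · exact hbc
  have sym : ∀ {u v : E}, ‖u - v‖ = 1 → ‖v - u‖ = 1 := norm_sub_eq_one_symm
  obtain ⟨h, hn, h1, h2, h3, h4⟩ := exists_common_functional hdim hang hxa hxc (sym hab) hbc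
    (hC _ hx _ hb) (hC _ ha _ hc) hxb hac
  obtain ⟨g, gn, g1, g2, g3, g4⟩ := exists_common_functional hdim hang hyx (sym hdy) (sym hxc) hcd
    (hC _ hy _ hc) (hC _ hx _ hd) hyc hxd
  have m1 := norm_add_eq_two_of_apply_eq_one hn hxa hxc h1 h2
  have m2 : ‖(x - c) + (x - y)‖ = 2 := by
    have := norm_add_eq_two_of_apply_eq_one gn (sym hxc) hyx g3 g1
    rwa [← norm_neg, show -((c - x) + (y - x)) = (x - c) + (x - y) by abel] at this
  have hxy := apply_eq_one_of_collinear
    (collinear_of_norm_midpoint hang hxa hxc (sym hyx) m1 m2) h1 h2 (by simpa using hac)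
  refine le_antisymm (hC _ hb _ hy) ?_
  have := StrongDual.le_norm hn (b - y)
  rw [show b - y = (b - a) - (x - a) + (x - y) by abel, map_add, map_sub, h3, h1, hxy] at this
  rw [show b - y = (b - a) - (x - a) + (x - y) by abel]
  linarith

/-- Two triangles of unit distances sharing a vertex. -/
theorem norm_sub_eq_one_of_triangles (hdim : Module.finrank ℝ E = 2) (hang : ¬ Angled E)
    {C : Set E} (hC : ∀ u ∈ C, ∀ v ∈ C, ‖u - v‖ ≤ 1) {a b c y x : E} (ha : a ∈ C) (hb : b ∈ C)
    (hc : c ∈ C) (hy : y ∈ C) (hx : x ∈ C) (hab : ‖a - b‖ = 1) (hbc : ‖b - c‖ = 1)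
    (hca : ‖c - a‖ = 1) (hay : ‖a - y‖ = 1) (hyx : ‖y - x‖ = 1) (hxa : ‖x - a‖ = 1) :
    (‖b - x‖ = 1 ∧ ‖c - y‖ = 1) ∨ (‖b - y‖ = 1 ∧ ‖c - x‖ = 1) := by
  obtain ⟨l, hl0, hl⟩ := exists_functional_eq hdim (b - c)
  rw [map_sub, sub_eq_zero] at hl
  have sym : ∀ {u v : E}, ‖u - v‖ = 1 → ‖v - u‖ = 1 := norm_sub_eq_one_symm
  have Z : ∀ {r z : E}, r ∈ C → z ∈ C → ‖r - z‖ = 1 → ‖a - z‖ = 1 → l r = l b →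
      r = b ∨ r = c := by
    intro r z hr hz hrz haz h
    rcases eq_or_eq_or_norm_sub_eq_one hdim hl0 hbc hrz (hC _ hb _ hr) (hC _ hc _ hr)
      (hC _ hb _ hz) (hC _ hc _ hz) hl h with h | h | h
    · exact .inl h
    · exact .inr h
    · exact (not_four_equidistant hdim hang hab (sym hca) haz hbc h.1 h.2).elim
  have X : ∀ {r z : E}, r ∈ C → z ∈ C → ‖r - z‖ = 1 → 0 < (l r - l b) * (l z - l b) →
      (‖b - r‖ = 1 ∧ ‖c - z‖ = 1) ∨ (‖b - z‖ = 1 ∧ ‖c - r‖ = 1) := fun {r z} hr hz hrz h ↦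
    norm_sub_eq_one_of_same_side hdim hbc hrz (hC _ hb _ hr) (hC _ hb _ hz) (hC _ hc _ hr)
      (hC _ hc _ hz) hl h
  have S : ∀ {b c y x : E}, b ∈ C → c ∈ C → y ∈ C → x ∈ C → ‖a - b‖ = 1 → ‖b - c‖ = 1 →
      ‖c - a‖ = 1 → ‖a - y‖ = 1 → ‖y - x‖ = 1 → ‖x - a‖ = 1 → ‖x - c‖ = 1 → ‖b - y‖ = 1 :=
    fun hb hc hy hx h1 h2 h3 h4 h5 h6 h7 ↦
      norm_sub_eq_one_of_six_cycle hdim hang hC ha hb hc ha hy hx h1 h2 h3 h4 h5 h6 h7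
        (ne_of_norm_sub_eq_one h3).symm (ne_of_norm_sub_eq_one h6)
  by_cases hla : l a - l b = 0
  · rcases Z ha hx (sym hxa) (sym hxa) (sub_eq_zero.1 hla) with rfl | rfl
    · simp at hab
    · simp at hca
  by_cases hlx : l x - l b = 0
  · rcases Z hx hy (sym hyx) hay (sub_eq_zero.1 hlx) with rfl | rfl
    · exact .inr ⟨sym hyx, sym hbc⟩
    · exact .inl ⟨hbc, sym hyx⟩
  by_cases hly : l y - l b = 0
  · rcases Z hy hx hyx (sym hxa) (sub_eq_zero.1 hly) with rfl | rfl
    · exact .inl ⟨hyx, sym hbc⟩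
    · exact .inr ⟨hbc, hyx⟩
  rcases lt_or_gt_of_ne (mul_ne_zero hlx hly) with h | h
  · have h' : 0 < (l x - l b) * (l a - l b) ∨ 0 < (l y - l b) * (l a - l b) := by
      by_contra! hcon
      have h1 := lt_of_le_of_ne hcon.1 (mul_ne_zero hlx hla)
      have h2 := lt_of_le_of_ne hcon.2 (mul_ne_zero hly hla)
      have := mul_pos_of_neg_of_neg h1 h2
      nlinarith [mul_neg_of_neg_of_pos h (by positivity : 0 < (l a - l b) ^ 2)]
    rcases h' with h' | h'
    · rcases X hx ha hxa h' with h | h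
      · exact .inl ⟨h.1, S hc hb hy hx (sym hca) (sym hbc) (sym hab) hay hyx hxa (sym h.1)⟩
      · exact .inr ⟨S hb hc hy hx hab hbc hca hay hyx hxa (sym h.2), h.2⟩
    · rcases X hy ha (sym hay) h' with h | h
      · exact .inr ⟨h.1, S hc hb hx hy (sym hca) (sym hbc) (sym hab) (sym hxa) (sym hyx) (sym hay)
          (sym h.1)⟩
      · exact .inl ⟨S hb hc hx hy hab hbc hca (sym hxa) (sym hyx) (sym hay) (sym h.2), h.2⟩
  · exact X hx hy (sym hyx) h

theorem norm_smul_add_smul_le_one {u v : E} {a b s r : ℝ} (hs : 0 ≤ s) (hsa : s ≤ a) (hr : 0 ≤ r)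
    (hrb : r ≤ b) (hu : ‖a • u‖ ≤ 1) (hv : ‖b • v‖ ≤ 1) (huv : ‖a • u + b • v‖ ≤ 1) :
    ‖s • u + r • v‖ ≤ 1 := by
  have key : ∀ {u v : E} {a b s r : ℝ}, 0 ≤ s → s ≤ a → 0 ≤ r → r ≤ b → ‖a • u‖ ≤ 1 →
      ‖a • u + b • v‖ ≤ 1 → r * a ≤ s * b → ‖s • u + r • v‖ ≤ 1 := by
    intro u v a b s r hs hsa hr hrb hu huv h
    rcases hr.eq_or_lt with rfl | hr
    · rcases hs.eq_or_lt with rfl | hs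
      · simp
      · have ha := hs.trans_le hsa
        rw [zero_smul, add_zero]
        refine le_trans ?_ hu
        rw [norm_smul_of_nonneg hs.le, norm_smul_of_nonneg ha.le]
        gcongr
    · have hb := hr.trans_le hrb
      rcases (hs.trans hsa).eq_or_lt with rfl | ha
      · obtain rfl : s = 0 := le_antisymm hsa hs
        rw [zero_smul, zero_add] at huv ⊢
        refine le_trans ?_ huv
        rw [norm_smul_of_nonneg hr.le, norm_smul_of_nonneg hb.le]
        gcongr
      · have := norm_le_of_eq_add (x := s • u + r • v) (u := a • u + b • v) (v := a • u)
          (a := r / b) (b := s / a - r / b) (by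
            rw [smul_add, smul_smul, smul_smul, smul_smul, sub_mul, div_mul_cancel₀ _ hb.ne',
              div_mul_cancel₀ _ ha.ne']
            module) (by positivity)
          (sub_nonneg.2 ((div_le_div_iff₀ hb ha).2 h))
        have h1 : s / a ≤ 1 := (div_le_one ha).2 hsa
        have h2 : 0 ≤ r / b := by positivity
        have h3 : 0 ≤ s / a - r / b := sub_nonneg.2 ((div_le_div_iff₀ hb ha).2 h)
        nlinarith
  rcases le_total (r * a) (s * b) with h | h
  · exact key hs hsa hr hrb hu huv h
  · rw [add_comm]
    exact key hr hrb hs hsa hv (by rwa [add_comm]) h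

theorem coeff_le_one_of_norm_sub_le {x y z : E} {α β : ℝ} (hx : ‖x‖ = 1) (hz : ‖z‖ ≤ 1)
    (hxy : ‖x - y‖ ≤ 1) (hα : 0 ≤ α) (hβ : 0 ≤ β) (h : z = α • x + β • y) : α ≤ 1 := by
  have := norm_le_of_eq_add (x := (α + β) • x) (u := z) (v := x - y) (a := 1) (b := β)
    (by rw [h]; module) zero_le_one hβ
  rw [norm_smul_of_nonneg (by positivity), hx] at this
  nlinarith

/-- The part of the unit circle between two points at distance at most one is covered by every
unit ball that contains the end points and the centre. -/
theorem norm_sub_le_one_of_mem_arc (hdim : Module.finrank ℝ E = 2) {x y z c : E} {α β : ℝ}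
    (hx : ‖x‖ = 1) (hy : ‖y‖ = 1) (hz : ‖z‖ = 1) (hα : 0 ≤ α) (hβ : 0 ≤ β)
    (h : z = α • x + β • y) (hxy : ‖x - y‖ ≤ 1) (hc : ‖c‖ ≤ 1) (hxc : ‖x - c‖ ≤ 1)
    (hyc : ‖y - c‖ ≤ 1) : ‖z - c‖ ≤ 1 := by
  have opp : ∀ {x y : E} {α β p q : ℝ}, ‖x‖ = 1 → ‖x - c‖ ≤ 1 → 0 ≤ α → 0 ≤ β →
      z = α • x + β • y → c = p • x + q • y → p ≤ 0 → 0 < q → ‖z - c‖ ≤ 1 := by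
    intro x y α β p q hx hxc hα hβ h hcpq hp hq
    have hp' : 0 ≤ -p := by linarith
    have e : z = (α + β / q * -p) • x + (β / q) • c := by
      rw [h, hcpq, smul_add, smul_smul, smul_smul, div_mul_cancel₀ _ hq.ne']
      module
    have hb : 0 ≤ β / q := by positivity
    have ha : 0 ≤ α + β / q * -p := by positivity
    generalize α + β / q * -p = a at e ha
    generalize β / q = b at e hb
    have ha1 := coeff_le_one_of_norm_sub_le hx hz.le hxc ha hb e
    rcases le_total b 1 with hb1 | hb1
    · have := norm_smul_add_smul_le_one (u := x) (v := -c) (a := 1) (b := 1) (s := a) (r := 1 - b)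
        ha ha1 (by linarith) (by linarith) (by simp [hx]) (by simpa using hc)
        (by simpa [← sub_eq_add_neg] using hxc)
      rwa [show z - c = a • x + (1 - b) • -c by rw [e]; module]
    · have hb0 : 0 < b := by linarith
      have := norm_le_of_eq_add (x := z - c) (u := a • x) (v := z) (a := 1 / b) (b := 1 - 1 / b)
        (by
          have : (1 / b) • z = (1 / b) • a • x + c := by
            rw [e, smul_add, smul_smul (1 / b) b, one_div_mul_cancel hb0.ne', one_smul]
          linear_combination (norm := module) this)
        (by positivity) (sub_nonneg.2 ((div_le_one hb0).2 hb1))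
      rw [norm_smul_of_nonneg ha, hx, hz] at this
      have h0 : 0 ≤ 1 / b := by positivity
      nlinarith
  have : FiniteDimensional ℝ E := .of_finrank_pos (by omega)
  by_cases hli : LinearIndependent ℝ ![x, y]
  · obtain ⟨p, q, hcpq⟩ : ∃ p q : ℝ, c = p • x + q • y := by
      have hs := hli.span_eq_top_of_card_eq_finrank (by simp [hdim])
      have : c ∈ Submodule.span ℝ (Set.range ![x, y]) := by rw [hs]; trivial
      rw [Matrix.range_cons, Matrix.range_cons, Matrix.range_empty, Set.union_empty,
        Set.singleton_union, Submodule.mem_span_pair] at this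
      obtain ⟨p, q, h⟩ := this
      exact ⟨p, q, h.symm⟩
    rcases lt_or_ge q 0 with hq | hq
    · rcases le_or_gt p 0 with hp | hp
      · have := coeff_le_one_of_norm_sub_le (z := y - c) (α := 1 - q) (β := -p) hy hyc
          (by rwa [norm_sub_rev]) (by linarith) (by linarith) (by rw [hcpq]; module)
        linarith
      · exact opp hy hyc hβ hα (by rw [h, add_comm]) (by rw [hcpq, add_comm]) hq.le hp
    rcases lt_or_ge p 0 with hp | hp
    · rcases hq.eq_or_lt with rfl | hq
      · have := coeff_le_one_of_norm_sub_le (z := x - c) (α := 1 - p) (β := -0) hx hxc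
          hxy (by linarith) (by linarith) (by rw [hcpq]; module)
        linarith
      · exact opp hx hxc hα hβ h hcpq hp.le hq
    have hyx : ‖y - x‖ ≤ 1 := by rwa [norm_sub_rev]
    have hα1 := coeff_le_one_of_norm_sub_le hx hz.le hxy hα hβ h
    have hβ1 := coeff_le_one_of_norm_sub_le hy hz.le hyx hβ hα (by rw [h, add_comm])
    have hp1 := coeff_le_one_of_norm_sub_le hx hc hxy hp hq hcpq
    have hq1 := coeff_le_one_of_norm_sub_le hy hc hyx hq hp (by rw [hcpq, add_comm])
    have nx : ∀ {a : ℝ}, 0 ≤ a → a ≤ 1 → ‖a • x‖ ≤ 1 := fun h0 h1 ↦ by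
      rwa [norm_smul_of_nonneg h0, hx, mul_one]
    have ny : ∀ {a : ℝ}, 0 ≤ a → a ≤ 1 → ‖a • y‖ ≤ 1 := fun h0 h1 ↦ by
      rwa [norm_smul_of_nonneg h0, hy, mul_one]
    rcases le_total p α with h1 | h1 <;> rcases le_total q β with h2 | h2
    · rw [show z - c = (α - p) • x + (β - q) • y by rw [h, hcpq]; module]
      exact norm_smul_add_smul_le_one (a := α) (b := β) (by linarith) (by linarith) (by linarith)
        (by linarith) (nx hα hα1) (ny hβ hβ1) (by rw [← h, hz])
    · rw [show z - c = (α - p) • x + (q - β) • -y by rw [h, hcpq]; module]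
      refine norm_smul_add_smul_le_one (a := 1 - p) (b := q) (by linarith) (by linarith)
        (by linarith) (by linarith) (nx (by linarith) (by linarith)) ?_ ?_
      · rw [smul_neg, norm_neg]; exact ny hq hq1
      · rwa [show (1 - p) • x + q • -y = x - c by rw [hcpq]; module]
    · rw [show z - c = (p - α) • -x + (β - q) • y by rw [h, hcpq]; module]
      refine norm_smul_add_smul_le_one (a := p) (b := 1 - q) (by linarith) (by linarith)
        (by linarith) (by linarith) ?_ (ny (by linarith) (by linarith)) ?_
      · rw [smul_neg, norm_neg]; exact nx hp hp1
      · rwa [show p • -x + (1 - q) • y = y - c by rw [hcpq]; module]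
    · rw [norm_sub_rev, show c - z = (p - α) • x + (q - β) • y by rw [h, hcpq]; module]
      exact norm_smul_add_smul_le_one (a := p) (b := q) (by linarith) (by linarith) (by linarith)
        (by linarith) (nx hp hp1) (ny hq hq1) (by rwa [← hcpq])
  · rw [LinearIndependent.pair_iff] at hli
    push Not at hli
    obtain ⟨s, t, hst, h0⟩ := hli
    have ht : t ≠ 0 := by
      rintro rfl
      have hs : s ≠ 0 := fun hs ↦ h0 hs rfl
      simp only [zero_smul, add_zero, smul_eq_zero, hs, false_or] at hst
      simp [hst] at hx
    have hy' : y = (-s / t) • x := by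
      have : t • y = (-s) • x := by linear_combination (norm := module) hst
      rw [div_eq_inv_mul, mul_smul, ← this, smul_smul, inv_mul_cancel₀ ht, one_smul]
    generalize -s / t = w at hy'
    rw [hy', norm_smul, hx, mul_one, Real.norm_eq_abs] at hy
    have hw : w = 1 := by
      rw [hy', show x - w • x = (1 - w) • x by module, norm_smul, hx, mul_one, Real.norm_eq_abs,
        abs_le] at hxy
      rcases abs_cases w with h | h <;> linarith
    rw [hw, one_smul] at hy'
    have hz' : z = (α + β) • x := by rw [h, hy']; module
    rw [hz', norm_smul_of_nonneg (by positivity), hx, mul_one] at hz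
    rwa [hz', hz, one_smul]

/-- The part of a complete set at distance one from one of its points is connected. -/
theorem isPreconnected_inter_sphere (hdim : Module.finrank ℝ E = 2) {C : Set E}
    (hC : ∀ u ∈ C, ∀ v ∈ C, ‖u - v‖ ≤ 1) (hmax : ∀ x, (∀ c ∈ C, ‖x - c‖ ≤ 1) → x ∈ C) {v : E}
    (hv : v ∈ C) : IsPreconnected {x ∈ C | ‖x - v‖ = 1} := by
  refine isPreconnected_of_forall_pair fun x ⟨hx, hxv⟩ y ⟨hy, hyv⟩ ↦ ?_
  let w : ℝ → E := fun s ↦ (1 - s) • (x - v) + s • (y - v)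
  have hw : ∀ s ∈ Icc (0 : ℝ) 1, 0 < ‖w s‖ := by
    rintro s ⟨hs0, hs1⟩
    have hxy := hC _ hx _ hy
    have h1 := norm_le_of_eq_add (x := x - v) (u := w s) (v := x - y) (a := 1) (b := s)
      (by simp only [w]; module) zero_le_one hs0
    have h2 := norm_le_of_eq_add (x := y - v) (u := w s) (v := y - x) (a := 1) (b := 1 - s)
      (by simp only [w]; module) zero_le_one (by linarith)
    rw [norm_sub_rev y x] at h2
    rw [hxv] at h1
    rw [hyv] at h2
    by_contra! hcon
    nlinarith
  refine ⟨Set.image (fun s ↦ v + ‖w s‖⁻¹ • w s) (Icc 0 1), ?_, ⟨0, by simp, ?_⟩,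
    ⟨1, by simp, ?_⟩, ?_⟩
  · rintro _ ⟨s, hs, rfl⟩
    have hn : ‖‖w s‖⁻¹ • w s‖ = 1 := by
      rw [norm_smul, norm_inv, norm_norm, inv_mul_cancel₀ (hw s hs).ne']
    refine ⟨hmax _ fun c hc ↦ ?_, by simpa using hn⟩
    have := norm_sub_le_one_of_mem_arc hdim (x := x - v) (y := y - v) (c := c - v)
      (α := ‖w s‖⁻¹ * (1 - s)) (β := ‖w s‖⁻¹ * s) hxv hyv hn
      (mul_nonneg (by positivity) (by linarith [hs.2])) (mul_nonneg (by positivity) hs.1)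
      (by simp only [w, smul_add, smul_smul]) (by simpa using hC _ hx _ hy) (hC _ hc _ hv)
      (by simpa using hC _ hx _ hc) (by simpa using hC _ hy _ hc)
    rwa [show v + ‖w s‖⁻¹ • w s - c = ‖w s‖⁻¹ • w s - (c - v) by abel]
  · simp [w, hxv]
  · simp [w, hyv]
  · refine isPreconnected_Icc.image _ ?_
    have hwc : Continuous w := by fun_prop
    exact continuousOn_const.add ((hwc.norm.continuousOn.inv₀ fun s hs ↦ (hw s hs).ne').smul
      hwc.continuousOn)

theorem exists_dist_eq_diam_of_isCompact {X : Type*} [PseudoMetricSpace X] {S : Set X}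
    (hS : IsCompact S) (hne : S.Nonempty) : ∃ x ∈ S, ∃ y ∈ S, dist x y = Metric.diam S := by
  obtain ⟨⟨x, y⟩, ⟨hx, hy⟩, hmax⟩ := (hS.prod hS).exists_isMaxOn (hne.prod hne)
    (f := fun p : X × X ↦ dist p.1 p.2) (by fun_prop)
  refine ⟨x, hx, y, hy, le_antisymm (Metric.dist_le_diam_of_mem hS.isBounded hx hy) ?_⟩
  exact Metric.diam_le_of_forall_dist_le dist_nonneg fun a ha b hb ↦
    hmax (show (a, b) ∈ S ×ˢ S from ⟨ha, hb⟩)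

theorem isBounded_of_diam_eq_one {X : Type*} [PseudoMetricSpace X] {S : Set X}
    (hd : Metric.diam S = 1) : Bornology.IsBounded S := by
  by_contra h
  simp [Metric.diam_eq_zero_of_unbounded h] at hd

theorem norm_sub_le_one_of_diam_eq_one {F : Type*} [NormedAddCommGroup F] {C : Set F}
    (hd : Metric.diam C = 1) : ∀ u ∈ C, ∀ v ∈ C, ‖u - v‖ ≤ 1 := fun u hu v hv ↦ by
  rw [← dist_eq_norm, ← hd]
  exact Metric.dist_le_diam_of_mem (isBounded_of_diam_eq_one hd) hu hv

theorem IsDiamComplete.mem_of_forall_norm_sub_le {F : Type*} [NormedAddCommGroup F] {C : Set F}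
    (hC : IsDiamComplete C) (hd : Metric.diam C = 1) (x : F) (hx : ∀ c ∈ C, ‖x - c‖ ≤ 1) :
    x ∈ C := by
  by_contra hxC
  have hb := isBounded_of_diam_eq_one hd
  refine hC ⟨insert x C, Set.ssubset_insert hxC, ?_⟩
  rw [hd]
  refine le_antisymm (Metric.diam_le_of_forall_dist_le zero_le_one ?_) ?_
  · rintro a (rfl | ha) b (rfl | hb)
    · simp
    · rw [dist_eq_norm]; exact hx b hb
    · rw [dist_comm, dist_eq_norm]; exact hx a ha
    · rw [dist_eq_norm]; exact norm_sub_le_one_of_diam_eq_one hd a ha b hb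
  · rw [← hd]
    exact Metric.diam_mono (Set.subset_insert x C) (hb.insert x)

/-- In a plane, every functional vanishing at a nonzero zero of `g` is a multiple of `g`. -/
theorem exists_eq_smul_of_apply_eq_zero (hdim : Module.finrank ℝ E = 2) {f g : StrongDual ℝ E}
    {e u : E} (he : e ≠ 0) (hg : g e = 0) (hf : f e = 0) (hu : g u ≠ 0) :
    ∃ c : ℝ, ∀ x, f x = c * g x := by
  have : FiniteDimensional ℝ E := .of_finrank_pos (by omega)
  have hg0 : (g : E →ₗ[ℝ] ℝ) ≠ 0 := fun h ↦ hu (LinearMap.congr_fun h u)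
  have hker : Module.finrank ℝ (LinearMap.ker (g : E →ₗ[ℝ] ℝ)) = 1 := by
    have := Module.Dual.finrank_ker_add_one_of_ne_zero hg0
    omega
  refine ⟨f u / g u, fun x ↦ ?_⟩
  obtain ⟨τ, hτ⟩ := (finrank_eq_one_iff_of_nonzero'
    (⟨e, hg⟩ : LinearMap.ker (g : E →ₗ[ℝ] ℝ)) fun h ↦ he (congrArg Subtype.val h)).1 hker
    ⟨x - (g x / g u) • u, by simp [hu]⟩
  have hτ' : τ • e = x - (g x / g u) • u := congrArg Subtype.val hτ
  have := congrArg f hτ'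
  simp only [map_smul, hf, map_sub, smul_eq_mul] at this
  field_simp at this ⊢
  linarith

theorem exists_lt_mul_nonneg_of_odd {a : ℕ → ℝ} {N : ℕ} (hN : Odd N) (ha : a N = a 0) :
    ∃ i < N, 0 ≤ a i * a (i + 1) := by
  by_contra! h
  have key : ∀ i ≤ N, 0 < (-1) ^ i * (a 0 * a i) := by
    have hN0 := hN.pos
    have h0 : a 0 ≠ 0 := fun h0 ↦ by simpa [h0] using h 0 hN0
    intro i hi
    induction i with
    | zero => simpa using mul_self_pos.2 h0
    | succ i ih =>
      have h1 := ih (by omega)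
      have h2 := h i (by omega)
      have h3 := mul_neg_of_pos_of_neg h1 h2
      have h4 : 0 < a i ^ 2 := by
        have : a i ≠ 0 := fun h ↦ by simp [h] at h2
        positivity
      rw [pow_succ]
      by_contra! h5
      have : ((-1) ^ i * (a 0 * a i)) * (a i * a (i + 1)) =
        -((-1) ^ i * -1 * (a 0 * a (i + 1))) * a i ^ 2 := by ring
      rw [this] at h3
      nlinarith [mul_nonneg (neg_nonneg.2 h5) h4.le]
  have := key N le_rfl
  rw [hN.neg_one_pow, ha] at this
  nlinarith [mul_self_nonneg (a 0)]

/-- The unit balls centred at the vertices of a closed walk of odd length in the unit distance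
graph of a complete set intersect in that set. -/
theorem eq_iInter_closedBall_of_odd_closed_walk (hdim : Module.finrank ℝ E = 2) {C : Set E}
    (hC : ∀ u ∈ C, ∀ v ∈ C, ‖u - v‖ ≤ 1) (hmax : ∀ x, (∀ c ∈ C, ‖x - c‖ ≤ 1) → x ∈ C)
    {N : ℕ} (hN : Odd N) {v : ℕ → E} (hper : ∀ i, v (i + N) = v i) (hv : ∀ i, v i ∈ C)
    (hadj : ∀ i, ‖v i - v (i + 1)‖ = 1) : C = ⋂ i : Fin N, Metric.closedBall (v i) 1 := by
  have hN0 := hN.pos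
  have hmem : ∀ {w}, (w ∈ ⋂ i : Fin N, Metric.closedBall (v i) 1) → ∀ i, ‖v i - w‖ ≤ 1 := by
    intro w hw i
    have hw' := Set.mem_iInter.1 hw ⟨i % N, Nat.mod_lt _ hN0⟩
    rw [mem_closedBall_iff_norm'] at hw'
    have hmod : ∀ q r, v (r + q * N) = v r := by
      intro q r
      induction q with
      | zero => simp
      | succ q ih => rw [Nat.succ_mul, ← add_assoc, hper, ih]
    rw [← Nat.mod_add_div' i N, hmod]
    exact hw'
  refine Set.Subset.antisymm (fun c hc ↦ Set.mem_iInter.2 fun i ↦ ?_) ?_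
  · rw [mem_closedBall_iff_norm]
    exact hC _ hc _ (hv _)
  choose F hF1 hF using fun x : E ↦ exists_dual_vector'' ℝ x
  simp only [RCLike.ofReal_real_eq_id, id_eq] at hF
  have hle : ∀ x u, F x u ≤ ‖u‖ := fun x u ↦ StrongDual.le_norm (hF1 x) u
  have hsub : C ⊆ ⋂ i : Fin N, Metric.closedBall (v i) 1 := fun c hc ↦ Set.mem_iInter.2 fun i ↦ by
    rw [mem_closedBall_iff_norm]
    exact hC _ hc _ (hv _)
  intro z hz
  refine hmax z fun z' hz' ↦ ?_
  replace hz' := hsub hz'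
  rcases eq_or_ne z z' with rfl | hne
  · simp
  set g := F (z - z') with hg
  have hgz : g (z - z') = ‖z - z'‖ := hF _
  have hgz0 : g (z - z') ≠ 0 := by
    rw [hgz]; exact norm_ne_zero_iff.2 (sub_ne_zero.2 hne)
  have : FiniteDimensional ℝ E := .of_finrank_pos (by omega)
  obtain ⟨e, he, hge⟩ : ∃ e : E, e ≠ 0 ∧ g e = 0 := by
    have hg0 : (g : E →ₗ[ℝ] ℝ) ≠ 0 := fun h ↦ hgz0 (LinearMap.congr_fun h _)
    have h1 := Module.Dual.finrank_ker_add_one_of_ne_zero hg0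
    have h2 : 0 < Module.finrank ℝ (LinearMap.ker (g : E →ₗ[ℝ] ℝ)) := by omega
    have := Module.finrank_pos_iff.1 h2
    obtain ⟨⟨e, he⟩, hne⟩ := exists_ne (0 : LinearMap.ker (g : E →ₗ[ℝ] ℝ))
    exact ⟨e, fun h ↦ hne (Subtype.ext h), he⟩
  let f : ℕ → StrongDual ℝ E := fun i ↦ F (v i - v (i + 1))
  obtain ⟨i, -, hi⟩ := exists_lt_mul_nonneg_of_odd (a := fun i ↦ f i e) hN (by
    simp only [f]
    rw [show v N = v 0 by simpa using hper 0, show v (N + 1) = v (0 + 1) by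
      rw [← hper (0 + 1), add_comm N, zero_add]])
  obtain ⟨α, β, hα, hβ, hαβ, h0⟩ : ∃ α β : ℝ, 0 ≤ α ∧ 0 ≤ β ∧ 0 < α + β ∧
      (α • f i - β • f (i + 1)) e = 0 := by
    simp only [_root_.sub_apply, _root_.smul_apply, smul_eq_mul]
    by_cases h : f i e = 0 ∧ f (i + 1) e = 0
    · exact ⟨1, 1, zero_le_one, zero_le_one, by norm_num, by simp [h.1, h.2]⟩
    · have hpos : 0 < |f i e| + |f (i + 1) e| := by
        rcases not_and_or.1 h with h | h
        · have := abs_pos.2 h; positivity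
        · have := abs_pos.2 h; positivity
      refine ⟨|f (i + 1) e|, |f i e|, abs_nonneg _, abs_nonneg _, by rwa [add_comm], ?_⟩
      rcases abs_cases (f i e) with h1 | h1 <;> rcases abs_cases (f (i + 1) e) with h2 | h2 <;>
        rw [h1.1, h2.1] <;> nlinarith
  obtain ⟨c, hc⟩ := exists_eq_smul_of_apply_eq_zero hdim he hge h0 hgz0
  simp only [_root_.sub_apply, _root_.smul_apply, smul_eq_mul] at hc
  have f1 : ∀ i, f i (v i - v (i + 1)) = 1 := fun i ↦ by simp only [f, hF, hadj]
  have side : ∀ w ∈ ⋂ i : Fin N, Metric.closedBall (v i) 1, 0 ≤ c * g (w - v (i + 1)) := by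
    intro w hw
    rw [← hc]
    have h1 : 0 ≤ f i (w - v (i + 1)) := by
      have h1 := (hle (v i - v (i + 1)) (v i - w)).trans (hmem hw i)
      have h2 := f1 i
      rw [show w - v (i + 1) = (v i - v (i + 1)) - (v i - w) by abel, map_sub, h2]
      simp only [f]
      linarith
    have h2 : f (i + 1) (w - v (i + 1)) ≤ 0 := by
      have h1 := (hle (v (i + 1) - v (i + 1 + 1)) (w - v (i + 1 + 1))).trans
        ((norm_sub_rev _ _).trans_le (hmem hw (i + 1 + 1)))
      have h2 := f1 (i + 1)
      rw [show w - v (i + 1) = (w - v (i + 1 + 1)) - (v (i + 1) - v (i + 1 + 1)) by abel, map_sub,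
        h2]
      simp only [f]
      linarith
    nlinarith
  have hgle : ∀ w ∈ ⋂ i : Fin N, Metric.closedBall (v i) 1, |g (w - v (i + 1))| ≤ 1 := by
    intro w hw
    have h1 := (g.le_of_opNorm_le (hF1 _) (w - v (i + 1)))
    rw [one_mul, Real.norm_eq_abs, norm_sub_rev] at h1
    exact h1.trans (hmem hw _)
  have hsplit : g (z - z') = g (z - v (i + 1)) - g (z' - v (i + 1)) := by
    rw [← map_sub]; congr 1; abel
  rw [← hgz, hsplit]
  have b1 := abs_le.1 (hgle z hz)
  have b2 := abs_le.1 (hgle z' hz')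
  have s1 := side z hz
  have s2 := side z' hz'
  rcases lt_trichotomy c 0 with hc0 | rfl | hc0
  · have : g (z - v (i + 1)) ≤ 0 := by by_contra! h; nlinarith
    linarith
  · exfalso
    have e1 := hc (v i - v (i + 1))
    have e2 := hc (v (i + 1) - v (i + 1 + 1))
    have l1 := (hle (v (i + 1) - v (i + 1 + 1)) (v i - v (i + 1))).trans_eq (hadj i)
    have l2 := (hle (v i - v (i + 1)) (v (i + 1) - v (i + 1 + 1))).trans_eq (hadj (i + 1))
    rw [f1] at e1 e2
    simp only [f] at e1 e2
    have hα' : 0 < α := by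
      by_contra! h
      obtain rfl : α = 0 := le_antisymm h hα
      nlinarith
    have v1 : F (v i - v (i + 1)) (v (i + 1) - v (i + 1 + 1)) = 1 := by nlinarith
    have l3 := (hle (v i - v (i + 1)) (v i - v (i + 1 + 1))).trans (hC _ (hv _) _ (hv _))
    rw [show v i - v (i + 1 + 1) = (v i - v (i + 1)) + (v (i + 1) - v (i + 1 + 1)) by abel,
      map_add, v1] at l3
    have := f1 i
    simp only [f] at this
    linarith
  · have : 0 ≤ g (z' - v (i + 1)) := by by_contra! h; nlinarith
    linarith

theorem mem_frontier_of_norm_sub_eq_one {C : Set E} (hC : ∀ u ∈ C, ∀ v ∈ C, ‖u - v‖ ≤ 1) {x y : E}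
    (hx : x ∈ C) (hy : y ∈ C) (hxy : ‖x - y‖ = 1) : x ∈ frontier C := by
  refine ⟨subset_closure hx, fun hint ↦ ?_⟩
  obtain ⟨ε, hε, hball⟩ := Metric.mem_nhds_iff.1 (mem_interior_iff_mem_nhds.1 hint)
  have hmem : x + (ε / 2) • (x - y) ∈ C := hball (by
    rw [mem_ball_iff_norm, add_sub_cancel_left, norm_smul_of_nonneg (by positivity), hxy]
    linarith)
  have := hC _ hmem _ hy
  rw [show x + (ε / 2) • (x - y) - y = (1 + ε / 2) • (x - y) by module,
    norm_smul_of_nonneg (by positivity), hxy] at this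
  linarith

theorem exists_norm_sub_eq_one_of_mem_frontier {F : Type*} [NormedAddCommGroup F] {C : Set F}
    {m : ℕ} {t : Fin m → F} (ht : C = ⋂ i, Metric.closedBall (t i) 1) {x : F}
    (hx : x ∈ frontier C) : x ∈ C ∧ ∃ i, ‖x - t i‖ = 1 := by
  have hcl : IsClosed C := by rw [ht]; exact isClosed_iInter fun i ↦ Metric.isClosed_closedBall
  have hxC := hcl.frontier_subset hx
  refine ⟨hxC, ?_⟩
  by_contra! hcon
  refine hx.2 (interior_mono (s := ⋂ i, Metric.ball (t i) 1) ?_ ?_)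
  · rw [ht]
    exact Set.iInter_mono fun i ↦ Metric.ball_subset_closedBall
  · rw [(isOpen_iInter_of_finite fun i ↦ Metric.isOpen_ball).interior_eq]
    refine Set.mem_iInter.2 fun i ↦ ?_
    have := Set.mem_iInter.1 (ht ▸ hxC : x ∈ ⋂ i, Metric.closedBall (t i) 1) i
    rw [mem_closedBall_iff_norm] at this
    rw [mem_ball_iff_norm]
    exact lt_of_le_of_ne this (hcon i)

theorem interior_iInter_closedBall_nonempty {m : ℕ} (hm : 0 < m) {t : Fin m → E}
    (ht : ∀ i j, ‖t i - t j‖ ≤ 1) : (interior (⋂ i, Metric.closedBall (t i) 1)).Nonempty := by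
  have hm' : (0 : ℝ) < m := by exact_mod_cast hm
  refine ⟨(m : ℝ)⁻¹ • ∑ i, t i, interior_mono (s := ⋂ i, Metric.ball (t i) 1) ?_ ?_⟩
  · exact Set.iInter_mono fun i ↦ Metric.ball_subset_closedBall
  · rw [(isOpen_iInter_of_finite fun i ↦ Metric.isOpen_ball).interior_eq]
    refine Set.mem_iInter.2 fun j ↦ ?_
    have e : (m : ℝ)⁻¹ • ∑ i, t i - t j = (m : ℝ)⁻¹ • ∑ i, (t i - t j) := by
      rw [Finset.sum_sub_distrib, smul_sub, Finset.sum_const, Finset.card_univ, Fintype.card_fin,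
        ← Nat.cast_smul_eq_nsmul ℝ, smul_smul, inv_mul_cancel₀ hm'.ne', one_smul]
    rw [mem_ball_iff_norm, e, norm_smul_of_nonneg (by positivity), inv_mul_lt_iff₀ hm', mul_one]
    calc ‖∑ i, (t i - t j)‖ ≤ ∑ i, ‖t i - t j‖ := norm_sum_le _ _
      _ < ∑ _i : Fin m, (1 : ℝ) :=
        Finset.sum_lt_sum (fun i _ ↦ ht i j) ⟨j, Finset.mem_univ _, by simp⟩
      _ = m := by simp

/-- The graph on `C` whose edges join points at distance one. -/
def unitDistGraph {F : Type*} [NormedAddCommGroup F] (C : Set F) : SimpleGraph F where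
  Adj x y := x ∈ C ∧ y ∈ C ∧ ‖x - y‖ = 1
  symm := ⟨fun _ _ h ↦ ⟨h.2.1, h.1, norm_sub_eq_one_symm h.2.2⟩⟩
  loopless := ⟨fun _ h ↦ ne_of_norm_sub_eq_one h.2.2 rfl⟩

theorem unitDistGraph_adj {F : Type*} [NormedAddCommGroup F] {C : Set F} {x y : F} :
    (unitDistGraph C).Adj x y ↔ x ∈ C ∧ y ∈ C ∧ ‖x - y‖ = 1 := Iff.rfl

/-- A Reuleaux polygon contains a closed walk of unit distances of odd length. -/
theorem exists_odd_closed_walk (hdim : Module.finrank ℝ E = 2) {C : Set E}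
    (hC : ∀ u ∈ C, ∀ v ∈ C, ‖u - v‖ ≤ 1) (hmax : ∀ x, (∀ c ∈ C, ‖x - c‖ ≤ 1) → x ∈ C)
    (hne : ∃ x ∈ C, ∃ y ∈ C, ‖x - y‖ = 1) {m : ℕ} {t : Fin m → E}
    (ht : C = ⋂ i, Metric.closedBall (t i) 1) :
    ∃ (u : E) (p : (unitDistGraph C).Walk u u), Odd p.length := by
  have : FiniteDimensional ℝ E := .of_finrank_pos (by omega)
  have htC : ∀ i, t i ∈ C := fun i ↦ hmax _ fun c hc ↦ by
    rw [← mem_closedBall_iff_norm']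
    exact Set.mem_iInter.1 (ht ▸ hc : c ∈ ⋂ i, Metric.closedBall (t i) 1) i
  obtain ⟨x, hx, y, hy, hxy⟩ := hne
  obtain ⟨-, i₀, hi₀⟩ := exists_norm_sub_eq_one_of_mem_frontier ht
    (mem_frontier_of_norm_sub_eq_one hC hx hy hxy)
  have hm : 0 < m := i₀.pos
  have hpre : IsPreconnected (frontier C) := by
    have hconv : Convex ℝ C := by
      rw [ht]; exact convex_iInter fun i ↦ convex_closedBall _ _
    have hbdd : Bornology.IsBounded C :=
      (Metric.isBounded_closedBall (x := t i₀) (r := 1)).subset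
        (ht ▸ Set.iInter_subset (fun i ↦ Metric.closedBall (t i) 1) i₀)
    obtain ⟨h, -, -, hf⟩ := exists_homeomorph_image_interior_closure_frontier_eq_unitBall hconv
      (ht ▸ interior_iInter_closedBall_nonempty hm fun i j ↦ hC _ (htC i) _ (htC j)) hbdd
    rw [← h.isPreconnected_image, hf]
    refine isPreconnected_sphere ?_ 0 1
    rw [← Module.finrank_eq_rank, hdim]
    exact_mod_cast one_lt_two
  let S : Set (Fin m) := {i | ∃ p : (unitDistGraph C).Walk (t i₀) (t i), Even p.length}
  have hcover := isPreconnected_closed_iff.1 hpre (⋃ i ∈ S, Metric.sphere (t i) 1)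
    (⋃ i ∈ Sᶜ, Metric.sphere (t i) 1)
    ((Set.toFinite _).isClosed_biUnion fun i _ ↦ Metric.isClosed_sphere)
    ((Set.toFinite _).isClosed_biUnion fun i _ ↦ Metric.isClosed_sphere) (by
      intro z hz
      obtain ⟨-, i, hi⟩ := exists_norm_sub_eq_one_of_mem_frontier ht hz
      by_cases hiS : i ∈ S
      · exact .inl (Set.mem_biUnion hiS (by rwa [mem_sphere_iff_norm]))
      · exact .inr (Set.mem_biUnion hiS (by rwa [mem_sphere_iff_norm])))
    ⟨x, mem_frontier_of_norm_sub_eq_one hC hx hy hxy,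
      Set.mem_biUnion (show i₀ ∈ S from ⟨.nil, by simp⟩) (by rwa [mem_sphere_iff_norm])⟩
  have hmemS : ∀ z ∈ frontier C, ∀ i, ‖z - t i‖ = 1 → i ∈ S := by
    intro z hz i hi
    by_contra hiS
    obtain ⟨w, hw, hw1, hw2⟩ := hcover ⟨z, hz, Set.mem_biUnion hiS (by rwa [mem_sphere_iff_norm])⟩
    simp only [Set.mem_iUnion, mem_sphere_iff_norm] at hw1 hw2
    obtain ⟨j, ⟨p, hp⟩, hwj⟩ := hw1
    obtain ⟨k, hk, hwk⟩ := hw2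
    have hwC := (exists_norm_sub_eq_one_of_mem_frontier ht hw).1
    have h1 : (unitDistGraph C).Adj (t j) w :=
      unitDistGraph_adj.2 ⟨htC j, hwC, norm_sub_eq_one_symm hwj⟩
    have h2 : (unitDistGraph C).Adj w (t k) := unitDistGraph_adj.2 ⟨hwC, htC k, hwk⟩
    refine hk ⟨p.append (.cons h1 (.cons h2 .nil)), ?_⟩
    simp only [SimpleGraph.Walk.length_append, SimpleGraph.Walk.length_cons,
      SimpleGraph.Walk.length_nil]
    exact hp.add even_two
  have hfr : t i₀ ∈ frontier C :=
    mem_frontier_of_norm_sub_eq_one hC (htC i₀) hx (norm_sub_eq_one_symm hi₀)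
  obtain ⟨-, i, hi⟩ := exists_norm_sub_eq_one_of_mem_frontier ht hfr
  obtain ⟨p, hp⟩ := hmemS _ hfr i hi
  have h1 : (unitDistGraph C).Adj (t i) (t i₀) :=
    unitDistGraph_adj.2 ⟨htC i, htC i₀, norm_sub_eq_one_symm hi⟩
  refine ⟨t i, .cons h1 p, ?_⟩
  rw [SimpleGraph.Walk.length_cons]
  exact hp.add_one

/-- A shortest odd closed walk in a graph, parametrised by residue classes. -/
theorem exists_shortest_odd_cycle {V : Type*} {G : SimpleGraph V}
    (h : ∃ (u : V) (p : G.Walk u u), Odd p.length) :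
    ∃ (N : ℕ) (v : ZMod N → V), Odd N ∧ 1 < N ∧ (∀ i, G.Adj (v i) (v (i + 1))) ∧
      ∀ (u : V) (p : G.Walk u u), Odd p.length → N ≤ p.length := by
  classical
  have h' : ∃ n, Odd n ∧ ∃ (u : V) (p : G.Walk u u), p.length = n := by
    obtain ⟨u, p, hp⟩ := h
    exact ⟨_, hp, u, p, rfl⟩
  obtain ⟨hodd, u, p, hp⟩ := Nat.find_spec h'
  set N := Nat.find h' with hN
  have hN1 : 1 < N := by
    by_contra! hN1
    have hN1 : N = 1 := by have := hodd.pos; omega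
    exact (G.loopless.irrefl u) (p.adj_of_length_eq_one (hp.trans hN1))
  have : NeZero N := ⟨by omega⟩
  have : Fact (1 < N) := ⟨hN1⟩
  refine ⟨N, fun i ↦ p.getVert i.val, hodd, hN1, fun i ↦ ?_, fun w q hq ↦
    Nat.find_min' h' ⟨hq, w, q, rfl⟩⟩
  have hlt := i.val_lt
  have hadj := p.adj_getVert_succ (i := i.val) (by omega)
  simp only [ZMod.val_add, ZMod.val_one]
  rcases Nat.lt_or_ge (i.val + 1) N with h1 | h1
  · rwa [Nat.mod_eq_of_lt h1]
  · have h2 : i.val + 1 = N := by omega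
    rw [h2, Nat.mod_self, p.getVert_zero]
    rwa [h2, p.getVert_of_length_le hp.le] at hadj

theorem exists_walk_of_cycle {V : Type*} {G : SimpleGraph V} {N : ℕ} {v : ZMod N → V}
    (hv : ∀ i, G.Adj (v i) (v (i + 1))) (i : ZMod N) (d : ℕ) :
    ∃ p : G.Walk (v i) (v (i + d)), p.length = d := by
  induction d with
  | zero => exact ⟨SimpleGraph.Walk.nil.copy rfl (by simp), by simp⟩
  | succ d ih =>
    obtain ⟨p, hp⟩ := ih
    refine ⟨(p.append (.cons (hv _) .nil)).copy rfl (by push_cast; rw [add_assoc]), ?_⟩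
    simp [hp]

/-- In a graph, walks between vertices of a shortest odd cycle are not shortcuts. -/
theorem exists_eq_add_of_walk {V : Type*} {G : SimpleGraph V} {N : ℕ} (hN : Odd N)
    {v : ZMod N → V} (hv : ∀ i, G.Adj (v i) (v (i + 1)))
    (hmin : ∀ (u : V) (p : G.Walk u u), Odd p.length → N ≤ p.length) {i j : ZMod N}
    (p : G.Walk (v i) (v j)) :
    ∃ e ≤ p.length, Even (e + p.length) ∧ (j = i + e ∨ j = i - e) := by
  have : NeZero N := ⟨hN.pos.ne'⟩
  have hlt := (j - i).val_lt
  have hd : (((j - i).val : ℕ) : ZMod N) = j - i := ZMod.natCast_zmod_val _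
  obtain ⟨q, hq⟩ := exists_walk_of_cycle hv i (j - i).val
  obtain ⟨r, hr⟩ := exists_walk_of_cycle hv j (N - (j - i).val)
  have e1 : i + ((j - i).val : ℕ) = j := by rw [hd]; abel
  have e2 : j + ((N - (j - i).val : ℕ) : ZMod N) = i := by
    rw [Nat.cast_sub hlt.le, ZMod.natCast_self, hd]; abel
  have h1 := hmin _ (p.append (q.copy rfl (by rw [e1])).reverse)
  have h2 := hmin _ (p.append (r.copy rfl (by rw [e2])))
  simp only [SimpleGraph.Walk.length_append, SimpleGraph.Walk.length_reverse,
    SimpleGraph.Walk.length_copy, hq, hr] at h1 h2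
  rcases Nat.even_or_odd (p.length + (j - i).val) with h | h
  · refine ⟨(j - i).val, ?_, by rwa [add_comm], .inl (by rw [hd]; abel)⟩
    have : Odd (p.length + (N - (j - i).val)) := by
      rw [Nat.odd_iff] at *; rw [Nat.even_iff] at h; omega
    have := h2 this
    omega
  · refine ⟨N - (j - i).val, ?_, ?_, .inr (by rw [eq_sub_iff_add_eq, e2])⟩
    · have := h1 h
      omega
    · rw [Nat.odd_iff] at *; rw [Nat.even_iff]; omega

theorem ZMod.two_ne_zero_of_odd {N : ℕ} (hN : Odd N) (h1 : 1 < N) : (2 : ZMod N) ≠ 0 := by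
  intro h
  have := (ZMod.natCast_eq_zero_iff 2 N).1 (by exact_mod_cast h)
  have := Nat.le_of_dvd (by norm_num) this
  obtain rfl : N = 2 := by omega
  exact absurd hN (by decide)

theorem ZMod.four_ne_zero_of_odd {N : ℕ} (hN : Odd N) (h1 : 1 < N) : (4 : ZMod N) ≠ 0 := by
  intro h
  have h4 := (ZMod.natCast_eq_zero_iff 4 N).1 (by exact_mod_cast h)
  have := Nat.le_of_dvd (by norm_num) h4
  interval_cases N
  · exact absurd hN (by decide)
  · exact absurd h4 (by decide)
  · exact absurd hN (by decide)

theorem ZMod.three_eq_zero_of_six_eq_zero {N : ℕ} (hN : Odd N) (h : (6 : ZMod N) = 0) :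
    (3 : ZMod N) = 0 := by
  have h6 := (ZMod.natCast_eq_zero_iff 6 N).1 (by exact_mod_cast h)
  have h3 : N ∣ 3 := by
    refine (Nat.Coprime.dvd_mul_left (Nat.Coprime.symm ?_)).1 (show N ∣ 2 * 3 from h6)
    exact (Nat.coprime_two_left).2 hN
  exact_mod_cast (ZMod.natCast_eq_zero_iff 3 N).2 h3

end NormedPlane

theorem ZMod.val_add_one_eq (M : ℕ) (j : ZMod (M + 1)) :
    (j + 1).val = j.val + 1 ∨ (j.val = M ∧ (j + 1).val = 0) := by
  rcases eq_or_lt_of_le (Nat.le_of_lt_succ (ZMod.val_lt j)) with h | h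
  · refine .inr ⟨h, ?_⟩
    have : j = Fin.last M := Fin.ext h
    rw [this]
    exact congrArg Fin.val (Fin.last_add_one M)
  · exact .inl (Fin.val_add_one_of_lt (n := M) (i := (j : Fin (M + 1))) h)

/-- The lower bound for multiple colorings of an odd cycle. -/
theorem le_of_forall_add_one_notMem {s k n : ℕ} (hs : 0 < s) (I : Fin n → Finset (ZMod (2 * s + 1)))
    (hI : ∀ i, ∀ j ∈ I i, j + 1 ∉ I i) (hk : ∀ j, k ≤ (Finset.univ.filter fun i ↦ j ∈ I i).card) :
    2 * k + (k + s - 1) / s ≤ n := by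
  have hcard : ∀ i, (I i).card ≤ s := by
    intro i
    have hdis : Disjoint (I i) ((I i).map (addRightEmbedding 1)) := by
      rw [Finset.disjoint_left]
      intro a ha hb
      obtain ⟨j, hj, rfl⟩ := Finset.mem_map.1 hb
      exact hI i j hj ha
    have := Finset.card_le_univ ((I i) ∪ ((I i).map (addRightEmbedding 1)))
    rw [Finset.card_union_of_disjoint hdis, Finset.card_map, ZMod.card] at this
    omega
  have hsum : (2 * s + 1) * k ≤ n * s :=
    calc (2 * s + 1) * k = ∑ _j : ZMod (2 * s + 1), k := by simp [ZMod.card]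
      _ ≤ ∑ j, (Finset.univ.filter fun i ↦ j ∈ I i).card := Finset.sum_le_sum fun j _ ↦ hk j
      _ = ∑ i, (I i).card := by
        simp only [Finset.card_filter]
        rw [Finset.sum_comm]
        simp
      _ ≤ ∑ _i : Fin n, s := Finset.sum_le_sum fun i _ ↦ hcard i
      _ = n * s := by simp
  have h2 : 2 * k ≤ n := by
    by_contra! h
    nlinarith
  obtain ⟨d, rfl⟩ := Nat.exists_eq_add_of_le h2
  have : k ≤ d * s := by nlinarith
  have : (k + s - 1) / s < d + 1 := by
    rw [Nat.div_lt_iff_lt_mul hs]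
    rw [add_mul]
    omega
  omega

/-- Multiple colorings of an odd cycle with the least number of colors. -/
theorem exists_multicoloring {s k d : ℕ} (hd : k ≤ s * d) :
    ∃ c : ZMod (2 * s + 1) → Finset (Fin (2 * k + d)), (∀ j, k ≤ (c j).card) ∧
      ∀ j, Disjoint (c j) (c (j + 1)) := by
  let a : ℕ → ℕ := fun i ↦ k - i * d
  let f : ℕ → Finset ℕ := fun j ↦ if Even j then Finset.Ico (a (j / 2)) (a (j / 2) + k) else
    Finset.range (2 * k + d) \ Finset.Ico (a (j / 2 + 1)) (a (j / 2) + k)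
  have hle : ∀ i, a i ≤ k := fun i ↦ Nat.sub_le _ _
  have hstep : ∀ i, a i ≤ a (i + 1) + d := fun i ↦ by
    simp only [a, add_mul]
    omega
  have hstep' : ∀ i, a (i + 1) ≤ a i := fun i ↦ by
    simp only [a, add_mul]
    omega
  have hlt : ∀ j, ∀ x ∈ f j, x < 2 * k + d := by
    intro j x hx
    have := hle (j / 2)
    simp only [f] at hx
    split_ifs at hx
    · have := Finset.mem_Ico.1 hx
      omega
    · exact Finset.mem_range.1 (Finset.mem_sdiff.1 hx).1
  have hcard : ∀ j, k ≤ (f j).card := by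
    intro j
    simp only [f]
    split_ifs
    · simp
    · have := Finset.le_card_sdiff (Finset.Ico (a (j / 2 + 1)) (a (j / 2) + k))
        (Finset.range (2 * k + d))
      have h1 := hstep (j / 2)
      rw [Finset.card_range, Nat.card_Ico] at this
      omega
  have hdisj : ∀ j, Disjoint (f j) (f (j + 1)) := by
    intro j
    rcases Nat.even_or_odd' j with ⟨i, rfl | rfl⟩
    · have h1 : ¬ Even (2 * i + 1) := by simp
      simp only [f, even_two_mul, if_true, h1, if_false]
      rw [show (2 * i + 1) / 2 = i by omega, show 2 * i / 2 = i by omega]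
      refine Finset.disjoint_sdiff.mono_left (Finset.Ico_subset_Ico_left (hstep' i))
    · have h1 : ¬ Even (2 * i + 1) := by simp
      have h2 : Even (2 * i + 1 + 1) := ⟨i + 1, by ring⟩
      simp only [f, h2, if_true, h1, if_false]
      rw [show (2 * i + 1) / 2 = i by omega, show (2 * i + 1 + 1) / 2 = i + 1 by omega]
      exact Finset.sdiff_disjoint.mono_right
        (Finset.Ico_subset_Ico_right (Nat.add_le_add_right (hstep' i) k))
  have hlast : Disjoint (f (2 * s)) (f 0) := by
    have h1 : a s = 0 := Nat.sub_eq_zero_of_le hd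
    have h2 : a 0 = k := by simp [a]
    simp only [f, even_two_mul, if_true, Even.zero, Nat.zero_div,
      show 2 * s / 2 = s by omega, h1, h2]
    rw [Finset.disjoint_left]
    intro x hx hx'
    rw [Finset.mem_Ico] at hx hx'
    omega
  refine ⟨fun j ↦ (f j.val).attachFin (hlt _), fun j ↦ by simpa using hcard _, fun j ↦ ?_⟩
  rw [Finset.disjoint_left]
  intro x hx hx'
  rw [Finset.mem_attachFin] at hx hx'
  rcases ZMod.val_add_one_eq (2 * s) j with h | ⟨h, h'⟩
  · rw [h] at hx'
    exact Finset.disjoint_left.1 (hdisj _) hx hx'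
  · rw [h] at hx
    rw [h'] at hx'
    exact Finset.disjoint_left.1 hlast hx hx'

section Cycle

variable {E : Type*} [NormedAddCommGroup E]

/-- The vertices `v i` form a shortest odd cycle in the unit distance graph of the complete set
`C` of diameter one. -/
structure IsReuleauxCycle (C : Set E) {N : ℕ} (v : ZMod N → E) : Prop where
  norm_sub_le : ∀ x ∈ C, ∀ y ∈ C, ‖x - y‖ ≤ 1
  maximal : ∀ x, (∀ c ∈ C, ‖x - c‖ ≤ 1) → x ∈ C
  odd : Odd N
  one_lt : 1 < N
  mem : ∀ i, v i ∈ C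
  adj : ∀ i, ‖v i - v (i + 1)‖ = 1
  shortest : ∀ (u : E) (p : (unitDistGraph C).Walk u u), Odd p.length → N ≤ p.length

/-- The points of `C` at distance one from `u`. -/
def unitNeighbors (C : Set E) (u : E) : Set E := {x ∈ C | ‖x - u‖ = 1}

/-- The common neighbors of `v (i - 1)` and `v (i + 1)`. -/
def wedge (C : Set E) {N : ℕ} (v : ZMod N → E) (i : ZMod N) : Set E :=
  {x ∈ C | ‖x - v (i - 1)‖ = 1 ∧ ‖x - v (i + 1)‖ = 1}

/-- The neighbors of `v i` that have to be attached to `v (i + 1)`. -/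
def posCore (C : Set E) {N : ℕ} (v : ZMod N → E) (i : ZMod N) : Set E :=
  wedge C v (i + 1) ∪ {x ∈ unitNeighbors C (v i) | ‖(x - v i) + (v (i + 1) - v i)‖ = 2 ∧
    ‖(v (i - 1) - v i) + (v (i + 1) - v i)‖ ≠ 2}

/-- The neighbors of `v i` that are at least as close to `posCore C v i` as to
`wedge C v (i - 1)`. -/
def posPart (C : Set E) {N : ℕ} (v : ZMod N → E) (i : ZMod N) : Set E :=
  {x ∈ unitNeighbors C (v i) |
    Metric.infDist x (posCore C v i) ≤ Metric.infDist x (wedge C v (i - 1))}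

/-- The neighbors of `v i` that are at least as close to `wedge C v (i - 1)` as to
`posCore C v i`. -/
def negPart (C : Set E) {N : ℕ} (v : ZMod N → E) (i : ZMod N) : Set E :=
  {x ∈ unitNeighbors C (v i) |
    Metric.infDist x (wedge C v (i - 1)) ≤ Metric.infDist x (posCore C v i)}

/-- The piece of the boundary of `C` attached to the vertex `v i`. -/
def vertexArc (C : Set E) {N : ℕ} (v : ZMod N → E) (i : ZMod N) : Set E :=
  posPart C v (i - 1) ∪ negPart C v (i + 1)

namespace IsReuleauxCycle

variable {C : Set E} {N : ℕ} {v : ZMod N → E}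

theorem graph_adj (hv : IsReuleauxCycle C v) (i : ZMod N) :
    (unitDistGraph C).Adj (v i) (v (i + 1)) := unitDistGraph_adj.2 ⟨hv.mem _, hv.mem _, hv.adj _⟩

theorem injective (hv : IsReuleauxCycle C v) : Function.Injective v := by
  intro i j hij
  obtain ⟨e, he, -, h⟩ := exists_eq_add_of_walk hv.odd hv.graph_adj hv.shortest
    (SimpleGraph.Walk.nil.copy rfl hij : (unitDistGraph C).Walk (v i) (v j))
  simp only [SimpleGraph.Walk.length_copy, SimpleGraph.Walk.length_nil, nonpos_iff_eq_zero] at he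
  subst he
  simpa [eq_comm] using h

theorem eq_or_eq_of_adj (hv : IsReuleauxCycle C v) {i j : ZMod N} (h : ‖v i - v j‖ = 1) :
    j = i + 1 ∨ j = i - 1 := by
  have h1 : (unitDistGraph C).Adj (v i) (v j) := unitDistGraph_adj.2 ⟨hv.mem _, hv.mem _, h⟩
  obtain ⟨e, he, hev, h⟩ := exists_eq_add_of_walk hv.odd hv.graph_adj hv.shortest
    (.cons h1 .nil)
  simp only [SimpleGraph.Walk.length_cons, SimpleGraph.Walk.length_nil, zero_add] at he hev
  interval_cases e
  · exact absurd hev (by decide)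
  · simpa using h

theorem eq_or_eq_or_eq_of_adj_adj (hv : IsReuleauxCycle C v) {i j : ZMod N} {x : E}
    (hx : x ∈ C) (h₁ : ‖x - v i‖ = 1) (h₂ : ‖x - v j‖ = 1) :
    j = i ∨ j = i + 2 ∨ j = i - 2 := by
  have h1 : (unitDistGraph C).Adj (v i) x :=
    unitDistGraph_adj.2 ⟨hv.mem _, hx, norm_sub_eq_one_symm h₁⟩
  have h2 : (unitDistGraph C).Adj x (v j) := unitDistGraph_adj.2 ⟨hx, hv.mem _, h₂⟩
  obtain ⟨e, he, hev, h⟩ := exists_eq_add_of_walk hv.odd hv.graph_adj hv.shortest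
    (.cons h1 (.cons h2 .nil))
  simp only [SimpleGraph.Walk.length_cons, SimpleGraph.Walk.length_nil, zero_add,
    Nat.reduceAdd] at he hev
  interval_cases e
  · left; simpa using h
  · exact absurd hev (by decide)
  · right; simpa using h

theorem cases_of_adj_adj_adj (hv : IsReuleauxCycle C v) {i j : ZMod N} {x y : E}
    (hx : x ∈ unitNeighbors C (v i)) (hy : y ∈ unitNeighbors C (v j)) (hxy : ‖x - y‖ = 1) :
    j = i + 1 ∨ j = i - 1 ∨ j = i + 3 ∨ j = i - 3 := by
  have h1 : (unitDistGraph C).Adj (v i) x :=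
    unitDistGraph_adj.2 ⟨hv.mem _, hx.1, norm_sub_eq_one_symm hx.2⟩
  have h2 : (unitDistGraph C).Adj x y := unitDistGraph_adj.2 ⟨hx.1, hy.1, hxy⟩
  have h3 : (unitDistGraph C).Adj y (v j) := unitDistGraph_adj.2 ⟨hy.1, hv.mem _, hy.2⟩
  obtain ⟨e, he, hev, h⟩ := exists_eq_add_of_walk hv.odd hv.graph_adj hv.shortest
    (.cons h1 (.cons h2 (.cons h3 .nil)))
  simp only [SimpleGraph.Walk.length_cons, SimpleGraph.Walk.length_nil, zero_add,
    Nat.reduceAdd] at he hev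
  interval_cases e
  · exact absurd hev (by decide)
  · rcases h with h | h
    · exact .inl (by simpa using h)
    · exact .inr (.inl (by simpa using h))
  · exact absurd hev (by decide)
  · rcases h with h | h
    · exact .inr (.inr (.inl (by simpa using h)))
    · exact .inr (.inr (.inr (by simpa using h)))

theorem three_eq_zero_of_triangle (hv : IsReuleauxCycle C v) {x y z : E} (hx : x ∈ C) (hy : y ∈ C)
    (hz : z ∈ C) (hxy : ‖x - y‖ = 1) (hyz : ‖y - z‖ = 1) (hzx : ‖z - x‖ = 1) :
    (3 : ZMod N) = 0 := by
  have h1 : (unitDistGraph C).Adj x y := unitDistGraph_adj.2 ⟨hx, hy, hxy⟩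
  have h2 : (unitDistGraph C).Adj y z := unitDistGraph_adj.2 ⟨hy, hz, hyz⟩
  have h3 : (unitDistGraph C).Adj z x := unitDistGraph_adj.2 ⟨hz, hx, hzx⟩
  have := hv.shortest x (.cons h1 (.cons h2 (.cons h3 .nil))) (by
    simp only [SimpleGraph.Walk.length_cons, SimpleGraph.Walk.length_nil]; decide)
  simp only [SimpleGraph.Walk.length_cons, SimpleGraph.Walk.length_nil, zero_add,
    Nat.reduceAdd] at this
  have h1 := hv.one_lt
  have h2 := hv.odd
  obtain rfl : N = 3 := by
    interval_cases N
    · exact absurd h2 (by decide)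
    · rfl
  rfl

theorem not_adj_add_three (hv : IsReuleauxCycle C v) (i : ZMod N) : ‖v i - v (i + 3)‖ ≠ 1 := by
  intro h
  rcases hv.eq_or_eq_of_adj h with h | h
  · exact ZMod.two_ne_zero_of_odd hv.odd hv.one_lt (by linear_combination h)
  · exact ZMod.four_ne_zero_of_odd hv.odd hv.one_lt (by linear_combination h)

theorem adj' (hv : IsReuleauxCycle C v) {i j : ZMod N} (h : j = i + 1) : ‖v i - v j‖ = 1 :=
  h ▸ hv.adj i

theorem isClosed (hv : IsReuleauxCycle C v) : IsClosed C := by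
  have : C = ⋂ c ∈ C, Metric.closedBall c 1 := by
    refine Set.Subset.antisymm (fun x hx ↦ Set.mem_iInter₂.2 fun c hc ↦ ?_) fun x hx ↦ ?_
    · rw [mem_closedBall_iff_norm]
      exact hv.norm_sub_le x hx c hc
    · refine hv.maximal x fun c hc ↦ ?_
      rw [← mem_closedBall_iff_norm]
      exact Set.mem_iInter₂.1 hx c hc
  rw [this]
  exact isClosed_biInter fun c _ ↦ Metric.isClosed_closedBall

theorem isClosed_unitNeighbors (hv : IsReuleauxCycle C v) (u : E) :
    IsClosed (unitNeighbors C u) :=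
  hv.isClosed.inter (isClosed_eq (by fun_prop) continuous_const)

theorem isClosed_wedge (hv : IsReuleauxCycle C v) (i : ZMod N) : IsClosed (wedge C v i) :=
  hv.isClosed.inter ((isClosed_eq (by fun_prop) continuous_const).inter
    (isClosed_eq (by fun_prop) continuous_const))

theorem isClosed_posCore (hv : IsReuleauxCycle C v) (i : ZMod N) : IsClosed (posCore C v i) := by
  refine (hv.isClosed_wedge _).union ?_
  refine (hv.isClosed_unitNeighbors _).inter ((isClosed_eq (by fun_prop) continuous_const).inter ?_)
  exact isClosed_const

theorem isClosed_posPart (hv : IsReuleauxCycle C v) (i : ZMod N) : IsClosed (posPart C v i) :=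
  (hv.isClosed_unitNeighbors _).inter
    (isClosed_le (Metric.continuous_infDist_pt _) (Metric.continuous_infDist_pt _))

theorem isClosed_negPart (hv : IsReuleauxCycle C v) (i : ZMod N) : IsClosed (negPart C v i) :=
  (hv.isClosed_unitNeighbors _).inter
    (isClosed_le (Metric.continuous_infDist_pt _) (Metric.continuous_infDist_pt _))

theorem isClosed_vertexArc (hv : IsReuleauxCycle C v) (i : ZMod N) :
    IsClosed (vertexArc C v i) :=
  (hv.isClosed_posPart _).union (hv.isClosed_negPart _)

theorem vertex_mem_wedge (hv : IsReuleauxCycle C v) (i : ZMod N) : v i ∈ wedge C v i :=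
  ⟨hv.mem i, norm_sub_eq_one_symm (hv.adj' (by ring)), hv.adj i⟩

theorem wedge_sub_one_subset (i : ZMod N) : wedge C v (i - 1) ⊆ unitNeighbors C (v i) :=
  fun x hx ↦ ⟨hx.1, by simpa using hx.2.2⟩

theorem wedge_add_one_subset (i : ZMod N) : wedge C v (i + 1) ⊆ unitNeighbors C (v i) :=
  fun x hx ↦ ⟨hx.1, by simpa using hx.2.1⟩

theorem vertex_ne (hv : IsReuleauxCycle C v) (i : ZMod N) : v (i - 2) ≠ v i := fun h ↦
  ZMod.two_ne_zero_of_odd hv.odd hv.one_lt (by linear_combination -hv.injective h)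

theorem vertex_mem_vertexArc (hv : IsReuleauxCycle C v) (i : ZMod N) : v i ∈ vertexArc C v i := by
  have h : v i ∈ wedge C v (i - 1 + 1) := by
    rw [sub_add_cancel]; exact hv.vertex_mem_wedge i
  refine .inl ⟨wedge_add_one_subset (i - 1) h, ?_⟩
  rw [Metric.infDist_zero_of_mem (.inl h)]
  exact Metric.infDist_nonneg

theorem vertexArc_subset (i : ZMod N) : vertexArc C v i ⊆ C := by
  rintro x (hx | hx)
  · exact hx.1.1
  · exact hx.1.1

theorem le_of_cover {s k n : ℕ} {v : ZMod (2 * s + 1) → E} (hv : IsReuleauxCycle C v)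
    (hd : Metric.diam C = 1) (F : Fin n → Set E)
    (hF : ∀ i, F i ⊆ C ∧ Metric.diam (F i) < Metric.diam C)
    (hk : ∀ x ∈ C, k ≤ {i : Fin n | x ∈ F i}.ncard) : 2 * k + (k + s - 1) / s ≤ n := by
  classical
  have hs : 0 < s := by
    have := hv.one_lt
    omega
  refine le_of_forall_add_one_notMem hs (fun i ↦ Finset.univ.filter fun j ↦ v j ∈ F i) ?_ ?_
  · intro i j hj hj'
    rw [Finset.mem_filter] at hj hj'
    have h := Metric.dist_le_diam_of_mem ((isBounded_of_diam_eq_one hd).subset (hF i).1) hj.2 hj'.2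
    rw [dist_eq_norm, hv.adj] at h
    linarith [(hF i).2]
  · intro j
    have := hk _ (hv.mem j)
    rw [Set.ncard_eq_toFinset_card'] at this
    simpa using this

end IsReuleauxCycle

end Cycle

section NormedPlane

variable {E : Type*} [NormedAddCommGroup E] [NormedSpace ℝ E]

namespace IsReuleauxCycle

variable {C : Set E} {N : ℕ} {v : ZMod N → E}

/-- A unit distance between neighbors of `v i` and of `v (i + 3)`. -/
theorem adj_of_neighbors_add_three (hdim : Module.finrank ℝ E = 2) (hang : ¬ Angled E)
    (hv : IsReuleauxCycle C v) {i : ZMod N} {x y : E} (hx : x ∈ unitNeighbors C (v i))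
    (hy : y ∈ unitNeighbors C (v (i + 3))) (hxy : ‖x - y‖ = 1) :
    (‖x - v (i + 2)‖ = 1 ∧ ‖y - v (i + 1)‖ = 1) ∨
      ((3 : ZMod N) = 0 ∧ ‖x - v (i + 1)‖ = 1 ∧ ‖y - v (i + 2)‖ = 1) := by
  have sym : ∀ {u v : E}, ‖u - v‖ = 1 → ‖v - u‖ = 1 := norm_sub_eq_one_symm
  have hab := hv.adj i
  have hbc := hv.adj' (i := i + 1) (j := i + 2) (by ring)
  have hcd := hv.adj' (i := i + 2) (j := i + 3) (by ring)
  have ha := hv.mem i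
  have hb := hv.mem (i + 1)
  have hc := hv.mem (i + 2)
  have hd := hv.mem (i + 3)
  by_cases h3 : (3 : ZMod N) = 0
  · rw [h3, add_zero] at hcd hy
    rcases norm_sub_eq_one_of_triangles hdim hang hv.norm_sub_le ha hb hc hy.1 hx.1 hab hbc hcd
      (sym hy.2) (sym hxy) hx.2 with h | h
    · exact .inr ⟨h3, sym h.1, sym h.2⟩
    · exact .inl ⟨sym h.2, sym h.1⟩
  · left
    have tri : ∀ {x y z : E}, x ∈ C → y ∈ C → z ∈ C → ‖x - y‖ = 1 → ‖y - z‖ = 1 →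
        ‖z - x‖ = 1 → False := fun hx hy hz h1 h2 h4 ↦
      h3 (hv.three_eq_zero_of_triangle hx hy hz h1 h2 h4)
    have had := hv.not_adj_add_three i
    have hac : v i ≠ v (i + 2) := fun h ↦ had (h ▸ hcd)
    have hdb : v (i + 3) ≠ v (i + 1) := fun h ↦ had (h ▸ hab)
    have hxd : x ≠ v (i + 3) := fun h ↦ had (sym (h ▸ hx.2))
    have hya : y ≠ v i := fun h ↦ had (h ▸ hy.2)
    rcases exists_chord_of_six_cycle hdim hv.norm_sub_le ha hb hc hd hy.1 hx.1 hab hbc hcd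
      (sym hy.2) (sym hxy) hx.2 with (h | h | h) | h | h | h | h | h | h
    · exact absurd h had
    · refine ⟨?_, sym h⟩
      exact sym (norm_sub_eq_one_of_six_cycle hdim hang hv.norm_sub_le hd hc hb ha hx.1 hy.1
        (sym hcd) (sym hbc) (sym hab) (sym hx.2) hxy hy.2 (sym h) hdb hya)
    · refine ⟨sym h, sym ?_⟩
      exact norm_sub_eq_one_of_six_cycle hdim hang hv.norm_sub_le ha hb hc hd hy.1 hx.1
        hab hbc hcd (sym hy.2) (sym hxy) hx.2 (sym h) hac hxd
    · exact (tri ha hb hc hab hbc (sym h)).elim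
    · exact (tri hb hc hd hbc hcd (sym h)).elim
    · exact (tri hc hd hy.1 hcd (sym hy.2) (sym h)).elim
    · exact (tri hd hy.1 hx.1 (sym hy.2) (sym hxy) (sym h)).elim
    · exact (tri hy.1 hx.1 ha (sym hxy) hx.2 (sym h)).elim
    · exact (tri hx.1 ha hb hx.2 hab (sym h)).elim

theorem disjoint_posCore (hdim : Module.finrank ℝ E = 2) (hang : ¬ Angled E)
    (hv : IsReuleauxCycle C v) (i : ZMod N) {x : E} (hx : x ∈ posCore C v i)
    (hx' : x ∈ wedge C v (i - 1)) : False := by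
  have hxi := wedge_sub_one_subset i hx'
  have hxC := hx'.1
  have h2 : ‖x - v (i - 2)‖ = 1 := by
    have := hx'.2.1
    rwa [show i - 1 - 1 = i - 2 by ring] at this
  rcases hx with hx | hx
  · have h1 : ‖x - v (i + 2)‖ = 1 := by
      have := hx.2.2
      rwa [show i + 1 + 1 = i + 2 by ring] at this
    rcases hv.eq_or_eq_or_eq_of_adj_adj hxC h1 h2 with h | h | h
    · exact ZMod.four_ne_zero_of_odd hv.odd hv.one_lt (by linear_combination -h)
    · have h3 := ZMod.three_eq_zero_of_six_eq_zero hv.odd (by linear_combination -h)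
      have e1 := hv.adj' (i := i) (j := i - 2) (by linear_combination -h3)
      have e2 := hv.adj' (i := i - 2) (j := i + 2) (by linear_combination h3)
      have e3 := hv.adj' (i := i + 2) (j := i) (by linear_combination -h3)
      exact not_four_equidistant hdim hang hxi.2 h2 h1 e1 (norm_sub_eq_one_symm e3) e2
    · exact ZMod.two_ne_zero_of_odd hv.odd hv.one_lt (by linear_combination -h)
  · obtain ⟨-, hflat, hn⟩ := hx
    have hpi : ‖v (i - 1) - v i‖ = 1 := hv.adj' (by ring)
    have hsi : ‖v (i + 1) - v i‖ = 1 := norm_sub_eq_one_symm (hv.adj i)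
    have hxp : x ≠ v (i - 1) := by
      rintro rfl
      exact hn hflat
    obtain ⟨h, hn1, h1, -, h3, -⟩ := exists_common_functional hdim hang hxi.2 h2 hpi
      (norm_sub_eq_one_symm (hv.adj' (by ring))) (hv.norm_sub_le _ hxC _ (hv.mem _))
      (hv.norm_sub_le _ (hv.mem _) _ (hv.mem _)) hxp (hv.vertex_ne i).symm
    have hcol := collinear_of_norm_midpoint hang hpi hxi.2 hsi
      (norm_add_eq_two_of_apply_eq_one hn1 hpi hxi.2 h3 h1) hflat
    have := apply_eq_one_of_collinear hcol h3 h1 (by simpa using hxp.symm)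
    exact hn (norm_add_eq_two_of_apply_eq_one hn1 hpi hsi h3 this)

theorem notMem_negPart (hdim : Module.finrank ℝ E = 2) (hang : ¬ Angled E)
    (hv : IsReuleauxCycle C v) {i : ZMod N} {x : E} (hx : x ∈ posCore C v i) :
    x ∉ negPart C v i := by
  rintro ⟨-, h⟩
  rw [Metric.infDist_zero_of_mem hx] at h
  refine hv.disjoint_posCore hdim hang i hx ?_
  rw [(hv.isClosed_wedge _).mem_iff_infDist_zero ⟨_, hv.vertex_mem_wedge _⟩]
  exact le_antisymm h Metric.infDist_nonneg

theorem notMem_posPart (hdim : Module.finrank ℝ E = 2) (hang : ¬ Angled E)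
    (hv : IsReuleauxCycle C v) {i : ZMod N} {x : E} (hx : x ∈ wedge C v (i - 1)) :
    x ∉ posPart C v i := by
  rintro ⟨-, h⟩
  rw [Metric.infDist_zero_of_mem hx] at h
  refine hv.disjoint_posCore hdim hang i ?_ hx
  rw [(hv.isClosed_posCore _).mem_iff_infDist_zero ⟨_, .inl (hv.vertex_mem_wedge _)⟩]
  exact le_antisymm h Metric.infDist_nonneg

theorem mem_posCore_or_mem_wedge (hdim : Module.finrank ℝ E = 2) (hang : ¬ Angled E)
    (hv : IsReuleauxCycle C v) {i : ZMod N} {x y : E} (hx : x ∈ unitNeighbors C (v i))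
    (hy : y ∈ unitNeighbors C (v (i + 1))) (hxy : ‖x - y‖ = 1) :
    x ∈ posCore C v i ∨ y ∈ wedge C v i := by
  rcases eq_or_ne x (v (i + 1)) with rfl | hxs
  · exact .inl (.inl (hv.vertex_mem_wedge _))
  rcases eq_or_ne y (v i) with rfl | hyi
  · exact .inr (hv.vertex_mem_wedge _)
  have sym : ∀ {u v : E}, ‖u - v‖ = 1 → ‖v - u‖ = 1 := norm_sub_eq_one_symm
  have hsi := sym (hv.adj i)
  have hpi : ‖v (i - 1) - v i‖ = 1 := hv.adj' (by ring)
  obtain ⟨h, hn, h1, h2, h3, h4⟩ := exists_common_functional hdim hang hx.2 hxy hsi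
    (sym hy.2) (hv.norm_sub_le _ hx.1 _ (hv.mem _)) (hv.norm_sub_le _ (hv.mem _) _ hy.1) hxs
    hyi.symm
  have hflat := norm_add_eq_two_of_apply_eq_one hn hx.2 hsi h1 h3
  by_cases hphi : ‖(v (i - 1) - v i) + (v (i + 1) - v i)‖ = 2
  · right
    have hcol := collinear_of_norm_midpoint hang hx.2 hsi hpi hflat (by rwa [add_comm])
    have h5 := apply_eq_one_of_collinear hcol h1 h3 (by simpa using hxs)
    have h6 : ‖v (i - 1) - y‖ = 1 := by
      refine le_antisymm (hv.norm_sub_le _ (hv.mem _) _ hy.1) ?_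
      have := StrongDual.le_norm hn (v (i - 1) - y)
      rw [show v (i - 1) - y = (v (i - 1) - v i) - (x - v i) + (x - y) by abel, map_add, map_sub,
        h5, h1, h2] at this
      rw [show v (i - 1) - y = (v (i - 1) - v i) - (x - v i) + (x - y) by abel]
      linarith
    exact ⟨hy.1, sym h6, hy.2⟩
  · exact .inl (.inr ⟨hx, hflat, hphi⟩)

theorem not_negPart_and_posPart (hdim : Module.finrank ℝ E = 2) (hang : ¬ Angled E)
    (hv : IsReuleauxCycle C v) {i : ZMod N} {x y : E} (hx : x ∈ negPart C v i)
    (hy : y ∈ posPart C v (i + 1)) : ‖x - y‖ ≠ 1 := by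
  intro hxy
  rcases hv.mem_posCore_or_mem_wedge hdim hang hx.1 hy.1 hxy with h | h
  · exact hv.notMem_negPart hdim hang h hx
  · exact hv.notMem_posPart hdim hang (by rwa [add_sub_cancel_right]) hy

theorem notMem_of_neighbors_add_three (hdim : Module.finrank ℝ E = 2) (hang : ¬ Angled E)
    (hv : IsReuleauxCycle C v) {i : ZMod N} {x y : E} (hx : x ∈ unitNeighbors C (v i))
    (hy : y ∈ unitNeighbors C (v (i + 3))) (hxy : ‖x - y‖ = 1) :
    (x ∉ negPart C v i ∧ y ∉ posPart C v (i + 3)) ∨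
      ((3 : ZMod N) = 0 ∧ x ∉ posPart C v i ∧ y ∉ negPart C v (i + 3)) := by
  rcases hv.adj_of_neighbors_add_three hdim hang hx hy hxy with h | ⟨h3, h⟩
  · refine .inl ⟨hv.notMem_negPart hdim hang (.inl ⟨hx.1, ?_, ?_⟩),
      hv.notMem_posPart hdim hang ⟨hy.1, ?_, ?_⟩⟩
    · simpa using hx.2
    · rw [show i + 1 + 1 = i + 2 by ring]; exact h.1
    · rw [show i + 3 - 1 - 1 = i + 1 by ring]; exact h.2
    · simpa using hy.2
  · refine .inr ⟨h3, hv.notMem_posPart hdim hang ⟨hx.1, ?_, ?_⟩,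
      hv.notMem_negPart hdim hang (.inl ⟨hy.1, ?_, ?_⟩)⟩
    · rw [show i - 1 - 1 = i + 1 by linear_combination -h3]; exact h.1
    · simpa using hx.2
    · simpa using hy.2
    · rw [show i + 3 + 1 + 1 = i + 2 by linear_combination h3]; exact h.2

theorem exists_mem_vertexArc (hdim : Module.finrank ℝ E = 2) (hv : IsReuleauxCycle C v) {x y : E}
    (hx : x ∈ C) (hy : y ∈ C) (hxy : ‖x - y‖ = 1) : ∃ i, x ∈ vertexArc C v i := by
  have hC := eq_iInter_closedBall_of_odd_closed_walk hdim hv.norm_sub_le hv.maximal hv.odd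
    (v := fun n : ℕ ↦ v n) (by simp) (fun i ↦ hv.mem _) (fun i ↦ by
      push_cast
      exact hv.adj _)
  obtain ⟨-, j, hj⟩ := exists_norm_sub_eq_one_of_mem_frontier hC
    (mem_frontier_of_norm_sub_eq_one hv.norm_sub_le hx hy hxy)
  rcases le_total (Metric.infDist x (posCore C v (j : ℕ)))
    (Metric.infDist x (wedge C v ((j : ℕ) - 1))) with h | h
  · refine ⟨(j : ℕ) + 1, .inl ?_⟩
    rw [add_sub_cancel_right]
    exact ⟨⟨hx, hj⟩, h⟩
  · refine ⟨(j : ℕ) - 1, .inr ?_⟩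
    rw [sub_add_cancel]
    exact ⟨⟨hx, hj⟩, h⟩

theorem eq_or_eq_of_mem_vertexArc (hdim : Module.finrank ℝ E = 2) (hang : ¬ Angled E)
    (hv : IsReuleauxCycle C v) {i j : ZMod N} {x y : E} (hx : x ∈ vertexArc C v i)
    (hy : y ∈ vertexArc C v j) (hxy : ‖x - y‖ = 1) : j = i + 1 ∨ j = i - 1 := by
  have hyx := norm_sub_eq_one_symm hxy
  have B : ∀ {a b : ZMod N} {x y : E}, x ∈ negPart C v a → y ∈ posPart C v b → ‖x - y‖ = 1 →
      b = a + 1 → False := by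
    rintro a _ x y hx hy hxy rfl
    exact hv.not_negPart_and_posPart hdim hang hx hy hxy
  have A : ∀ {a b : ZMod N} {x y : E}, x ∈ unitNeighbors C (v a) → y ∈ unitNeighbors C (v b) →
      ‖x - y‖ = 1 → b = a + 3 → (x ∉ negPart C v a ∧ y ∉ posPart C v b) ∨
      ((3 : ZMod N) = 0 ∧ x ∉ posPart C v a ∧ y ∉ negPart C v b) := by
    rintro a _ x y hx hy hxy rfl
    exact hv.notMem_of_neighbors_add_three hdim hang hx hy hxy
  rcases hx with hx | hx <;> rcases hy with hy | hy
  · rcases hv.cases_of_adj_adj_adj hx.1 hy.1 hxy with h | h | h | h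
    · left; linear_combination h
    · right; linear_combination h
    · rcases A hx.1 hy.1 hxy h with h' | h'
      exacts [absurd hy h'.2, absurd hx h'.2.1]
    · rcases A hy.1 hx.1 hyx (by linear_combination -h) with h' | h'
      exacts [absurd hx h'.2, absurd hy h'.2.1]
  · rcases hv.cases_of_adj_adj_adj hx.1 hy.1 hxy with h | h | h | h
    · right; linear_combination h
    · exact (B hy hx hyx (by linear_combination -h)).elim
    · rcases A hx.1 hy.1 hxy h with h' | h'
      · left; linear_combination h
      · exact absurd hx h'.2.1
    · rcases A hy.1 hx.1 hyx (by linear_combination -h) with h' | h'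
      · exact absurd hy h'.1
      · left; linear_combination h - 2 * h'.1
  · rcases hv.cases_of_adj_adj_adj hx.1 hy.1 hxy with h | h | h | h
    · exact (B hx hy hxy h).elim
    · left; linear_combination h
    · rcases A hx.1 hy.1 hxy h with h' | h'
      · exact absurd hx h'.1
      · right; linear_combination h + 2 * h'.1
    · rcases A hy.1 hx.1 hyx (by linear_combination -h) with h' | h'
      · right; linear_combination h
      · exact absurd hy h'.2.1
  · rcases hv.cases_of_adj_adj_adj hx.1 hy.1 hxy with h | h | h | h
    · left; linear_combination h
    · right; linear_combination h
    · rcases A hx.1 hy.1 hxy h with h' | h'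
      exacts [absurd hx h'.1, absurd hy h'.2.2]
    · rcases A hy.1 hx.1 hyx (by linear_combination -h) with h' | h'
      exacts [absurd hy h'.1, absurd hx h'.2.2]

theorem vertexArc_inter_nonempty (hdim : Module.finrank ℝ E = 2) (hv : IsReuleauxCycle C v)
    (i : ZMod N) : (vertexArc C v (i - 1) ∩ vertexArc C v (i + 1)).Nonempty := by
  have hpre : IsPreconnected (unitNeighbors C (v i)) :=
    isPreconnected_inter_sphere hdim hv.norm_sub_le hv.maximal (hv.mem i)
  have hpos : (unitNeighbors C (v i) ∩ posPart C v i).Nonempty := by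
    have h := hv.vertex_mem_wedge (i + 1)
    refine ⟨_, wedge_add_one_subset i h, wedge_add_one_subset i h, ?_⟩
    rw [Metric.infDist_zero_of_mem (.inl h)]
    exact Metric.infDist_nonneg
  have hneg : (unitNeighbors C (v i) ∩ negPart C v i).Nonempty := by
    have h := hv.vertex_mem_wedge (i - 1)
    refine ⟨_, wedge_sub_one_subset i h, wedge_sub_one_subset i h, ?_⟩
    rw [Metric.infDist_zero_of_mem h]
    exact Metric.infDist_nonneg
  obtain ⟨z, -, h1, h2⟩ := isPreconnected_closed_iff.1 hpre (posPart C v i) (negPart C v i)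
    (hv.isClosed_posPart i) (hv.isClosed_negPart i)
    (fun x hx ↦ (le_total (Metric.infDist x (posCore C v i))
      (Metric.infDist x (wedge C v (i - 1)))).imp (fun h ↦ ⟨hx, h⟩) fun h ↦ ⟨hx, h⟩) hpos hneg
  exact ⟨z, .inr (by rwa [sub_add_cancel]), .inl (by rwa [add_sub_cancel_right])⟩

/-- The number of vertices of a shortest odd cycle is the number of sides. -/
theorem le_of_eq_iInter (hdim : Module.finrank ℝ E = 2) (hang : ¬ Angled E)
    (hv : IsReuleauxCycle C v) {m : ℕ} {t : Fin m → E}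
    (ht : C = ⋂ i, Metric.closedBall (t i) 1) : N ≤ m := by
  have : NeZero N := ⟨hv.odd.pos.ne'⟩
  have htC : ∀ i, t i ∈ C := fun i ↦ hv.maximal _ fun c hc ↦ by
    rw [← mem_closedBall_iff_norm']
    exact Set.mem_iInter.1 (ht ▸ hc : c ∈ ⋂ i, Metric.closedBall (t i) 1) i
  have key : ∀ i : ZMod N, ∃ k, t k ∈ vertexArc C v i ∧ ∀ j, t k ∈ vertexArc C v j → j = i := by
    intro i
    obtain ⟨z, h1, h2⟩ := hv.vertexArc_inter_nonempty hdim i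
    have hzC := vertexArc_subset _ h1
    have hfr : z ∈ frontier C := by
      rcases h1 with h | h
      · exact mem_frontier_of_norm_sub_eq_one hv.norm_sub_le hzC (hv.mem _) h.1.2
      · exact mem_frontier_of_norm_sub_eq_one hv.norm_sub_le hzC (hv.mem _) h.1.2
    obtain ⟨-, k, hk⟩ := exists_norm_sub_eq_one_of_mem_frontier ht hfr
    have hu : ∀ j, t k ∈ vertexArc C v j → j = i := by
      intro j hj
      rcases hv.eq_or_eq_of_mem_vertexArc hdim hang h1 hj hk with e1 | e1
      · rwa [sub_add_cancel] at e1
      · rcases hv.eq_or_eq_of_mem_vertexArc hdim hang h2 hj hk with e2 | e2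
        · exact (ZMod.four_ne_zero_of_odd hv.odd hv.one_lt (by linear_combination e1 - e2)).elim
        · rwa [add_sub_cancel_right] at e2
    obtain ⟨j, hj⟩ := hv.exists_mem_vertexArc hdim (htC k) hzC (norm_sub_eq_one_symm hk)
    exact ⟨k, hu j hj ▸ hj, hu⟩
  choose τ hτ hu using key
  have hinj : Function.Injective τ := fun i j hij ↦ hu j i (hij ▸ hτ i)
  simpa [ZMod.card] using Fintype.card_le_of_injective τ hinj

theorem exists_closed_cover (hdim : Module.finrank ℝ E = 2) (hang : ¬ Angled E)
    (hv : IsReuleauxCycle C v) : ∃ B : ZMod N → Set E,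
      (∀ j, IsClosed (B j) ∧ B j ⊆ C) ∧ (∀ x ∈ C, ∃ j, x ∈ B j) ∧
      ∀ i j, ∀ x ∈ B i, ∀ y ∈ B j, ‖x - y‖ = 1 → j = i + 1 ∨ i = j + 1 := by
  have : NeZero N := ⟨hv.odd.pos.ne'⟩
  let B : ZMod N → Set E := fun j ↦ C ∩ ⋂ l,
    {x | Metric.infDist x (vertexArc C v j) ≤ Metric.infDist x (vertexArc C v l)}
  have hB : ∀ j, ∀ x ∈ B j, ∀ y ∈ C, ‖x - y‖ = 1 → x ∈ vertexArc C v j := by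
    intro j x hx y hy hxy
    obtain ⟨l, hl⟩ := hv.exists_mem_vertexArc hdim hx.1 hy hxy
    rw [(hv.isClosed_vertexArc j).mem_iff_infDist_zero ⟨_, hv.vertex_mem_vertexArc j⟩]
    refine le_antisymm ?_ Metric.infDist_nonneg
    rw [← Metric.infDist_zero_of_mem hl]
    exact Set.mem_iInter.1 hx.2 l
  refine ⟨B, fun j ↦ ⟨?_, fun x hx ↦ hx.1⟩, fun x hx ↦ ?_, fun i j x hx y hy hxy ↦ ?_⟩
  · exact hv.isClosed.inter (isClosed_iInter fun l ↦
      isClosed_le (Metric.continuous_infDist_pt _) (Metric.continuous_infDist_pt _))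
  · obtain ⟨j, hj⟩ := Finite.exists_min fun l ↦ Metric.infDist x (vertexArc C v l)
    exact ⟨j, hx, Set.mem_iInter.2 hj⟩
  · refine (hv.eq_or_eq_of_mem_vertexArc hdim hang (hB i x hx y hy.1 hxy)
      (hB j y hy x hx.1 (norm_sub_eq_one_symm hxy)) hxy).imp_right fun h ↦ ?_
    rw [h, sub_add_cancel]

theorem exists_cover (hdim : Module.finrank ℝ E = 2) (hang : ¬ Angled E) {s k d : ℕ}
    {v : ZMod (2 * s + 1) → E} (hv : IsReuleauxCycle C v) (hd : Metric.diam C = 1)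
    (hk : k ≤ s * d) : ∃ F : Fin (2 * k + d) → Set E,
      (∀ i, F i ⊆ C ∧ Metric.diam (F i) < Metric.diam C) ∧
      ∀ x ∈ C, k ≤ {i | x ∈ F i}.ncard := by
  have : FiniteDimensional ℝ E := .of_finrank_pos (by omega)
  have : ProperSpace E := FiniteDimensional.proper_real E
  obtain ⟨B, hB, hcover, hadj⟩ := hv.exists_closed_cover hdim hang
  obtain ⟨c, hc, hdisj⟩ := exists_multicoloring (s := s) hk
  have hsub : ∀ i, (⋃ j ∈ {j | i ∈ c j}, B j) ⊆ C := fun i ↦ Set.iUnion₂_subset fun j _ ↦ (hB j).2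
  refine ⟨fun i ↦ ⋃ j ∈ {j | i ∈ c j}, B j, fun i ↦ ⟨hsub i, ?_⟩, fun x hx ↦ ?_⟩
  · have hcl : IsClosed (⋃ j ∈ {j | i ∈ c j}, B j) :=
      (Set.toFinite _).isClosed_biUnion fun j _ ↦ (hB j).1
    have hcpt := Metric.isCompact_of_isClosed_isBounded hcl
      ((isBounded_of_diam_eq_one hd).subset (hsub i))
    rw [hd]
    change Metric.diam (⋃ j ∈ {j | i ∈ c j}, B j) < 1
    rcases (⋃ j ∈ {j | i ∈ c j}, B j).eq_empty_or_nonempty with h | h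
    · rw [h, Metric.diam_empty]
      exact one_pos
    · obtain ⟨x, hx, y, hy, hxy⟩ := exists_dist_eq_diam_of_isCompact hcpt h
      rw [← hxy, dist_eq_norm]
      refine lt_of_le_of_ne (hv.norm_sub_le _ (hsub i hx) _ (hsub i hy)) fun h1 ↦ ?_
      obtain ⟨j, hj, hxj⟩ := Set.mem_iUnion₂.1 hx
      obtain ⟨l, hl, hyl⟩ := Set.mem_iUnion₂.1 hy
      rcases hadj j l x hxj y hyl h1 with rfl | rfl
      · exact Finset.disjoint_left.1 (hdisj _) hj hl
      · exact Finset.disjoint_left.1 (hdisj _) hl hj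
  · obtain ⟨j, hj⟩ := hcover x hx
    refine (hc j).trans ?_
    rw [← Set.ncard_coe_finset]
    exact Set.ncard_le_ncard (fun i hi ↦ Set.mem_biUnion (show j ∈ {j | i ∈ c j} from hi) hj)
      (Set.toFinite _)

theorem borsukNum_eq (hdim : Module.finrank ℝ E = 2) (hang : ¬ Angled E) {s : ℕ}
    {v : ZMod (2 * s + 1) → E} (hv : IsReuleauxCycle C v) (hd : Metric.diam C = 1) (k : ℕ) :
    borsukNum C k = ((2 * k + (k + s - 1) / s : ℕ) : ℕ∞) := by
  have hs : 0 < s := by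
    have := hv.one_lt
    omega
  refine le_antisymm (sInf_le ⟨_, rfl, hv.exists_cover hdim hang hd ?_⟩) (le_sInf ?_)
  · have := Nat.div_add_mod (k + s - 1) s
    have := Nat.mod_lt (k + s - 1) hs
    omega
  · rintro _ ⟨n, rfl, F, hF, hk⟩
    exact_mod_cast hv.le_of_cover hd F hF hk

end IsReuleauxCycle

theorem exists_isReuleauxCycle (hdim : Module.finrank ℝ E = 2) {C : Set E} (hC : IsDiamComplete C)
    (hd : Metric.diam C = 1) {m : ℕ} {t : Fin m → E} (ht : C = ⋂ i, Metric.closedBall (t i) 1) :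
    ∃ (N : ℕ) (v : ZMod N → E), IsReuleauxCycle C v := by
  have : FiniteDimensional ℝ E := .of_finrank_pos (by omega)
  have : ProperSpace E := FiniteDimensional.proper_real E
  have hle := norm_sub_le_one_of_diam_eq_one hd
  have hmax := hC.mem_of_forall_norm_sub_le hd
  have hcl : IsClosed C := ht ▸ isClosed_iInter fun i ↦ Metric.isClosed_closedBall
  have hne : C.Nonempty := by
    by_contra h
    simp [Set.not_nonempty_iff_eq_empty.1 h] at hd
  obtain ⟨x, hx, y, hy, hxy⟩ := exists_dist_eq_diam_of_isCompact
    (Metric.isCompact_of_isClosed_isBounded hcl (isBounded_of_diam_eq_one hd)) hne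
  rw [hd, dist_eq_norm] at hxy
  obtain ⟨N, v, hN, h1, hadj, hshort⟩ := exists_shortest_odd_cycle
    (exists_odd_closed_walk hdim hle hmax ⟨x, hx, y, hy, hxy⟩ ht)
  exact ⟨N, v, hle, hmax, hN, h1, fun i ↦ (hadj i).1, fun i ↦ (hadj i).2.2, hshort⟩

end NormedPlane

theorem borsuk_reuleaux {E : Type*} [NormedAddCommGroup E] [NormedSpace ℝ E]
    (hdim : Module.finrank ℝ E = 2) (hang : ¬ Angled E)
    (C : Set E) (hC : IsDiamComplete C) (hd : Metric.diam C = 1)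
    -- C is an m-sided Reuleaux polygon
    (m : ℕ) (hm : ∃ t : Fin m → E, C = ⋂ i, Metric.closedBall (t i) 1)
    (hmin : ∀ n : ℕ, (∃ t : Fin n → E, C = ⋂ i, Metric.closedBall (t i) 1) → m ≤ n) :
    Odd m ∧ ∀ s k : ℕ, m = 2 * s + 1 → 0 < k →
      borsukNum C k = ((2 * k + (k + s - 1) / s : ℕ) : ℕ∞) := by
  obtain ⟨t, ht⟩ := hm
  obtain ⟨N, v, hv⟩ := exists_isReuleauxCycle hdim hC hd ht
  obtain rfl : m = N := le_antisymm
    (hmin N ⟨_, eq_iInter_closedBall_of_odd_closed_walk hdim hv.norm_sub_le hv.maximal hv.odd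
      (v := fun n : ℕ ↦ v n) (by simp) (fun i ↦ hv.mem _) fun i ↦ by
        push_cast
        exact hv.adj _⟩)
    (hv.le_of_eq_iInter hdim hang ht)
  refine ⟨hv.odd, ?_⟩
  rintro s k rfl -
  exact hv.borsukNum_eq hdim hang hd k
end

section
/- Let P be a centrally symmetric convex polygon with 2m vertices (m ≥ 2) in the plane, considered as the unit ball of its own norm. Then the k-fold Borsuk number of P with respect to this norm is a_k(P) = 2k + ⌈2k/(m−1)⌉ for every positive integer k. -/
open Set

section PlaneDet

variable {E : Type*} [NormedAddCommGroup E] [NormedSpace ℝ E]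

/-- The determinant of two vectors of a real plane identified with `ℂ`. -/
noncomputable def planeDet (e : E ≃ₗ[ℝ] ℂ) (x y : E) : ℝ :=
  (e x).re * (e y).im - (e x).im * (e y).re

lemma planeDet_self (e : E ≃ₗ[ℝ] ℂ) (x : E) : planeDet e x x = 0 := by
  simp only [planeDet]; ring

lemma planeDet_swap (e : E ≃ₗ[ℝ] ℂ) (x y : E) : planeDet e x y = -planeDet e y x := by
  simp only [planeDet]; ring

lemma planeDet_add_right (e : E ≃ₗ[ℝ] ℂ) (x y z : E) :
    planeDet e x (y + z) = planeDet e x y + planeDet e x z := by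
  simp only [planeDet, map_add, Complex.add_re, Complex.add_im]; ring

lemma planeDet_smul_right (e : E ≃ₗ[ℝ] ℂ) (x y : E) (c : ℝ) :
    planeDet e x (c • y) = c * planeDet e x y := by
  simp only [planeDet, map_smul, Complex.smul_re, Complex.smul_im, smul_eq_mul]; ring

lemma planeDet_neg_right (e : E ≃ₗ[ℝ] ℂ) (x y : E) : planeDet e x (-y) = -planeDet e x y := by
  simp only [planeDet, map_neg, Complex.neg_re, Complex.neg_im]; ring

lemma planeDet_neg_left (e : E ≃ₗ[ℝ] ℂ) (x y : E) : planeDet e (-x) y = -planeDet e x y := by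
  simp only [planeDet, map_neg, Complex.neg_re, Complex.neg_im]; ring

lemma planeDet_smul_eq (e : E ≃ₗ[ℝ] ℂ) (a b x : E) :
    planeDet e a b • x = planeDet e x b • a + planeDet e a x • b := by
  apply e.injective
  apply Complex.ext <;>
    simp only [planeDet, map_add, map_smul, Complex.add_re, Complex.add_im, Complex.smul_re,
      Complex.smul_im, smul_eq_mul] <;> ring

lemma planeDet_mul_planeDet (e : E ≃ₗ[ℝ] ℂ) (a b c x : E) :
    planeDet e a b * planeDet e c x =
      planeDet e c b * planeDet e a x + planeDet e a c * planeDet e b x := by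
  simp only [planeDet]; ring

lemma continuous_planeDet_right [FiniteDimensional ℝ E] (e : E ≃ₗ[ℝ] ℂ) (x : E) :
    Continuous (planeDet e x) := by
  have he : Continuous e := e.toLinearMap.continuous_of_finiteDimensional
  unfold planeDet
  fun_prop

lemma exists_eq_smul_of_planeDet_eq_zero (e : E ≃ₗ[ℝ] ℂ) {p w : E} (hp : p ≠ 0)
    (h : planeDet e p w = 0) : ∃ c : ℝ, w = c • p := by
  set b := e.symm (Complex.I * e p) with hb
  have hpos : planeDet e p b = Complex.normSq (e p) := by
    simp [planeDet, hb, Complex.normSq_apply]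
  have hne : planeDet e p b ≠ 0 := by
    rw [hpos]; simpa using hp
  have key := planeDet_smul_eq e p b w
  rw [h, zero_smul, add_zero] at key
  exact ⟨(planeDet e p b)⁻¹ * planeDet e w b, by rw [mul_smul, ← key, inv_smul_smul₀ hne]⟩

lemma planeDet_eq_norm_mul_sin (e : E ≃ₗ[ℝ] ℂ) (x y : E) :
    planeDet e x y = ‖e x‖ * ‖e y‖ * Real.sin ((e y).arg - (e x).arg) := by
  have hx := Complex.norm_mul_cos_arg (e x)
  have hx' := Complex.norm_mul_sin_arg (e x)
  have hy := Complex.norm_mul_cos_arg (e y)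
  have hy' := Complex.norm_mul_sin_arg (e y)
  rw [Real.sin_sub, planeDet, ← hx, ← hx', ← hy, ← hy']
  ring

end PlaneDet

section Enumeration

variable {E : Type*} [NormedAddCommGroup E] [NormedSpace ℝ E]

lemma norm_eq_one_of_mem_extremePoints_closedBall [Nontrivial E] {p : E}
    (hp : p ∈ Set.extremePoints ℝ (Metric.closedBall (0 : E) 1)) : ‖p‖ = 1 := by
  have h1 : ‖p‖ ≤ 1 := by simpa using hp.1
  refine h1.antisymm (not_lt.1 fun hlt ↦ ?_)
  obtain ⟨u, hu⟩ := exists_norm_eq E (c := 1 - ‖p‖) (by linarith)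
  have ha : p + u ∈ Metric.closedBall (0 : E) 1 := by
    have := norm_add_le p u
    simp only [mem_closedBall_zero_iff]; linarith
  have hb : p - u ∈ Metric.closedBall (0 : E) 1 := by
    have := norm_sub_le p u
    simp only [mem_closedBall_zero_iff]; linarith
  have hseg : p ∈ openSegment ℝ (p + u) (p - u) :=
    ⟨1 / 2, 1 / 2, by norm_num, by norm_num, by norm_num, by module⟩
  have : u = 0 := by simpa using hp.2 ha hb hseg
  rw [this, norm_zero] at hu
  linarith

lemma neg_mem_extremePoints_closedBall {p : E}
    (hp : p ∈ Set.extremePoints ℝ (Metric.closedBall (0 : E) 1)) :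
    -p ∈ Set.extremePoints ℝ (Metric.closedBall (0 : E) 1) := by
  refine ⟨by simpa using hp.1, fun x hx y hy ⟨a, b, ha, hb, hab, h⟩ ↦ ?_⟩
  have := hp.2 (x₁ := -x) (by simpa using hx) (x₂ := -y) (by simpa using hy)
    ⟨a, b, ha, hb, hab, by rw [smul_neg, smul_neg, ← neg_add, h, neg_neg]⟩
  rw [← this, neg_neg]

lemma arg_neg_pos_iff {z : ℂ} (hz : z ≠ 0) : 0 < (-z).arg ↔ ¬ 0 < z.arg := by
  have key : ∀ w : ℂ, 0 < w.arg ↔ 0 < w.im ∨ (w.im = 0 ∧ w.re < 0) := by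
    intro w
    constructor
    · intro h
      rcases (Complex.arg_nonneg_iff.1 h.le).lt_or_eq with h' | h'
      · exact Or.inl h'
      · refine Or.inr ⟨h'.symm, not_le.1 fun hre ↦ h.ne' ?_⟩
        exact Complex.arg_eq_zero_iff.2 ⟨hre, h'.symm⟩
    · intro h
      have h0 : 0 ≤ w.arg := Complex.arg_nonneg_iff.2 (by rcases h with h | h <;> linarith)
      refine lt_of_le_of_ne h0 fun h1 ↦ ?_
      obtain ⟨hre, him⟩ := Complex.arg_eq_zero_iff.1 h1.symm
      rcases h with h | h <;> linarith
  rw [key, key]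
  have hz' : ¬ (z.re = 0 ∧ z.im = 0) := fun h ↦ hz (Complex.ext h.1 h.2)
  simp only [Complex.neg_im, Complex.neg_re]
  grind

/-- The vertices of a centrally symmetric polygon, listed counterclockwise. -/
lemma exists_enumeration_extremePoints [Nontrivial E] (e : E ≃ₗ[ℝ] ℂ) {m : ℕ} (hm : 0 < m)
    (hfin : (Set.extremePoints ℝ (Metric.closedBall (0 : E) 1)).Finite)
    (hcard : (Set.extremePoints ℝ (Metric.closedBall (0 : E) 1)).ncard = 2 * m) :
    ∃ p : ℤ → E, Set.range p = Set.extremePoints ℝ (Metric.closedBall (0 : E) 1) ∧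
      (∀ i, p (i + m) = -p i) ∧ ∀ i j : ℤ, i < j → j < i + m → 0 < planeDet e (p i) (p j) := by
  classical
  set V := hfin.toFinset with hV
  have memV : ∀ v, v ∈ V ↔ v ∈ Set.extremePoints ℝ (Metric.closedBall (0 : E) 1) := by
    simp [hV]
  have hVcard : V.card = 2 * m := by rw [← hcard, Set.ncard_eq_toFinset_card _ hfin]
  have hnorm : ∀ v ∈ V, ‖v‖ = 1 := fun v hv ↦
    norm_eq_one_of_mem_extremePoints_closedBall ((memV v).1 hv)
  have hne : ∀ v ∈ V, v ≠ 0 := fun v hv h ↦ by simpa [h] using hnorm v hv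
  have hneg : ∀ v ∈ V, -v ∈ V := fun v hv ↦
    (memV _).2 (neg_mem_extremePoints_closedBall ((memV v).1 hv))
  have hne' : ∀ v ∈ V, e v ≠ 0 := fun v hv h ↦ hne v hv (by simpa using h)
  set H := V.filter (fun v ↦ 0 < (e v).arg) with hH
  have memH : ∀ v, v ∈ H ↔ v ∈ V ∧ 0 < (e v).arg := by simp [hH]
  have hinj : ∀ v ∈ V, ∀ w ∈ V, (e v).arg = (e w).arg → v = w := by
    intro v hv w hw h
    have hc : planeDet e v w = 0 := by rw [planeDet_eq_norm_mul_sin, h]; simp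
    obtain ⟨c, rfl⟩ := exists_eq_smul_of_planeDet_eq_zero e (hne v hv) hc
    have h1 := hnorm _ hw
    rw [norm_smul, hnorm v hv, mul_one, Real.norm_eq_abs] at h1
    rcases eq_or_eq_neg_of_abs_eq h1 with rfl | rfl
    · simp
    · have := arg_neg_pos_iff (hne' v hv)
      simp only [neg_smul, one_smul, map_neg] at h
      rw [← h] at this
      tauto
  have hHcard : H.card = m := by
    have h2 : (V.filter (fun v ↦ ¬ 0 < (e v).arg)).card = H.card := by
      refine Finset.card_bij' (fun v _ ↦ -v) (fun v _ ↦ -v) ?_ ?_ ?_ ?_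
      · intro v hv
        rw [Finset.mem_filter] at hv
        rw [memH, map_neg, arg_neg_pos_iff (hne' v hv.1)]
        exact ⟨hneg v hv.1, hv.2⟩
      · intro v hv
        rw [memH] at hv
        rw [Finset.mem_filter, map_neg, arg_neg_pos_iff (hne' v hv.1), not_not]
        exact ⟨hneg v hv.1, hv.2⟩
      · simp
      · simp
    have := Finset.card_filter_add_card_filter_not (s := V) (fun v ↦ 0 < (e v).arg)
    rw [h2, hVcard, ← hH] at this
    omega
  set A := H.image (fun v ↦ (e v).arg) with hA
  have hAcard : A.card = m := by
    rw [hA, Finset.card_image_of_injOn, hHcard]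
    intro v hv w hw h
    exact hinj v ((memH v).1 hv).1 w ((memH w).1 hw).1 h
  have hq : ∀ i : Fin m, ∃ v, v ∈ H ∧ (e v).arg = A.orderEmbOfFin hAcard i := by
    intro i
    simpa only [hA, Finset.mem_image] using A.orderEmbOfFin_mem hAcard i
  choose q hqH hqarg using hq
  have hqV : ∀ i, q i ∈ V := fun i ↦ ((memH _).1 (hqH i)).1
  have hqsurj : ∀ v ∈ H, ∃ i, q i = v := by
    intro v hv
    have : (e v).arg ∈ Set.range (A.orderEmbOfFin hAcard) := by
      rw [Finset.range_orderEmbOfFin]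
      exact Finset.mem_coe.2 (Finset.mem_image_of_mem (fun v ↦ (e v).arg) hv)
    obtain ⟨i, hi⟩ := this
    exact ⟨i, hinj _ (hqV i) _ ((memH v).1 hv).1 ((hqarg i).trans hi)⟩
  have hqpos : ∀ i j, i < j → 0 < planeDet e (q i) (q j) := by
    intro i j hij
    have h1 : (e (q i)).arg < (e (q j)).arg := by
      rw [hqarg, hqarg]; exact (A.orderEmbOfFin hAcard).strictMono hij
    have h2 := ((memH _).1 (hqH i)).2
    have h3 := Complex.arg_le_pi (e (q j))
    rw [planeDet_eq_norm_mul_sin]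
    have := Real.sin_pos_of_pos_of_lt_pi (x := (e (q j)).arg - (e (q i)).arg)
      (by linarith) (by linarith)
    have h4 := norm_pos_iff.2 (hne' _ (hqV i))
    have h5 := norm_pos_iff.2 (hne' _ (hqV j))
    positivity
  have hm0 : (0 : ℤ) < m := by exact_mod_cast hm
  have hmod : ∀ i : ℤ, (i % m).toNat < m := by
    intro i
    have h1 := Int.emod_nonneg i hm0.ne'
    have h2 := Int.emod_lt_of_pos i hm0
    omega
  set r : ℤ → Fin m := fun i ↦ ⟨(i % m).toNat, hmod i⟩ with hr
  set p : ℤ → E := fun i ↦ if Even (i / m) then q (r i) else -q (r i) with hp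
  have hradd : ∀ i : ℤ, r (i + m) = r i := by
    intro i; simp [hr]
  have hpadd : ∀ i, p (i + m) = -p i := by
    intro i
    have hdiv : (i + m) / (m : ℤ) = i / m + 1 := Int.add_ediv_of_dvd_right dvd_rfl |>.trans
      (by rw [Int.ediv_self hm0.ne'])
    simp only [hp, hradd, hdiv, Int.even_add_one]
    by_cases h : Even (i / (m : ℤ)) <;> simp [h]
  refine ⟨p, ?_, hpadd, ?_⟩
  · ext v
    rw [← memV]
    constructor
    · rintro ⟨i, rfl⟩
      simp only [hp]
      split_ifs
      · exact hqV _
      · exact hneg _ (hqV _)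
    · intro hv
      have hpq : ∀ i : Fin m, p (i : ℕ) = q i := by
        intro i
        have h1 : ((i : ℕ) : ℤ) / m = 0 := Int.ediv_eq_zero_of_lt (by positivity)
          (by exact_mod_cast i.2)
        have h2 : ((i : ℕ) : ℤ) % m = (i : ℕ) := Int.emod_eq_of_lt (by positivity)
          (by exact_mod_cast i.2)
        simp [hp, hr, h1, h2]
      by_cases h : 0 < (e v).arg
      · obtain ⟨i, hi⟩ := hqsurj v ((memH v).2 ⟨hv, h⟩)
        exact ⟨(i : ℕ), by rw [hpq, hi]⟩
      · rw [← arg_neg_pos_iff (hne' v hv), ← map_neg] at h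
        obtain ⟨i, hi⟩ := hqsurj (-v) ((memH _).2 ⟨hneg v hv, h⟩)
        exact ⟨(i : ℕ) + m, by rw [hpadd, hpq, hi, neg_neg]⟩
  · intro i j hij hjm
    have ei := Int.emod_add_mul_ediv i m
    have ej := Int.emod_add_mul_ediv j m
    have i1 := Int.emod_nonneg i hm0.ne'
    have i2 := Int.emod_lt_of_pos i hm0
    have j1 := Int.emod_nonneg j hm0.ne'
    have j2 := Int.emod_lt_of_pos j hm0
    have hle : i / (m : ℤ) ≤ j / m := Int.ediv_le_ediv hm0 hij.le
    have hle' : j / (m : ℤ) ≤ i / m + 1 := by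
      have := Int.ediv_le_ediv hm0 hjm.le
      rwa [Int.add_ediv_of_dvd_right dvd_rfl, Int.ediv_self hm0.ne'] at this
    rcases (show j / (m : ℤ) = i / m ∨ j / (m : ℤ) = i / m + 1 by omega) with h | h
    · rw [h] at ej
      have hlt : r i < r j := by
        simp only [hr, Fin.mk_lt_mk]; omega
      have := hqpos _ _ hlt
      simp only [hp, h]
      split_ifs
      · exact this
      · simpa [planeDet_neg_left, planeDet_neg_right] using this
    · rw [h, mul_add, mul_one] at ej
      have hlt : r j < r i := by
        simp only [hr, Fin.mk_lt_mk]; omega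
      have := hqpos _ _ hlt
      rw [planeDet_swap] at this
      simp only [hp, h, Int.even_add_one]
      by_cases hev : Even (i / (m : ℤ)) <;>
        simpa [hev, planeDet_neg_left, planeDet_neg_right] using this

end Enumeration

section Polygon

variable {E : Type*} [NormedAddCommGroup E] [NormedSpace ℝ E]

/-- The line through two antipodal vertices of the unit ball separates diametral pairs. -/
lemma dist_lt_two_of_planeDet_pos [Nontrivial E] (e : E ≃ₗ[ℝ] ℂ) {p x y : E}
    (hp : p ∈ Set.extremePoints ℝ (Metric.closedBall (0 : E) 1)) (hx : ‖x‖ ≤ 1) (hy : ‖y‖ ≤ 1)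
    (hpx : 0 < planeDet e p x) (hpy : 0 < planeDet e p y) : dist x y < 2 := by
  by_contra! hxy
  rw [dist_eq_norm] at hxy
  have hp1 := norm_eq_one_of_mem_extremePoints_closedBall hp
  have hp0 : p ≠ 0 := by rintro rfl; simp at hp1
  set s := planeDet e p x
  set t := planeDet e p y
  have hst : 0 < s + t := by positivity
  set a := t / (s + t) with ha
  set b := s / (s + t) with hb
  have ha0 : 0 < a := by positivity
  have hb0 : 0 < b := by positivity
  have hab : a + b = 1 := by rw [ha, hb]; field_simp; ring
  set w := a • x + b • (-y) with hw
  have hcw : planeDet e p w = 0 := by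
    rw [hw, planeDet_add_right, planeDet_smul_right, planeDet_smul_right, planeDet_neg_right]
    change a * s + b * -t = 0
    rw [ha, hb]; field_simp; ring
  have hcomb : ∀ c d : ℝ, 0 < c → 0 < d → c + d = 1 → ‖c • x + d • (-y)‖ ≤ 1 := by
    intro c d hc hd hcd
    refine (norm_add_le _ _).trans ?_
    rw [norm_smul, norm_smul, norm_neg, Real.norm_of_nonneg hc.le, Real.norm_of_nonneg hd.le]
    nlinarith
  have hw1 : ‖w‖ = 1 := by
    refine (hcomb a b ha0 hb0 hab).antisymm ?_
    have h1 := hcomb b a hb0 ha0 (by linarith)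
    have h2 : x - y = w + (b • x + a • (-y)) := by
      rw [hw, show x - y = (a + b) • x + (a + b) • (-y) by rw [hab]; module]
      module
    have h3 := norm_add_le w (b • x + a • (-y))
    rw [← h2] at h3
    linarith
  obtain ⟨c, hc⟩ := exists_eq_smul_of_planeDet_eq_zero e hp0 hcw
  rw [hc, norm_smul, hp1, mul_one, Real.norm_eq_abs] at hw1
  rcases eq_or_eq_neg_of_abs_eq hw1 with rfl | rfl
  · have hxp : x = p := hp.2 (x₁ := x) (by simpa using hx) (x₂ := -y) (by simpa using hy)
      ⟨a, b, ha0, hb0, hab, by rw [← hw, hc, one_smul]⟩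
    exact hpx.ne' (by simp only [s]; rw [hxp, planeDet_self])
  · have hyp : y = p := hp.2 (x₁ := y) (by simpa using hy) (x₂ := -x) (by simpa using hx)
      ⟨b, a, hb0, ha0, by linarith, by
        rw [show b • y + a • (-x) = -w by rw [hw]; module, hc]; simp⟩
    exact hpy.ne' (by simp only [t]; rw [hyp, planeDet_self])

/-- Two neighbouring vertices span an edge of the unit ball. -/
lemma norm_add_eq_two_of_planeDet_pos [FiniteDimensional ℝ E] (e : E ≃ₗ[ℝ] ℂ) {a b : E}
    (ha : ‖a‖ = 1) (hb : ‖b‖ = 1) (hab : 0 < planeDet e a b)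
    (h : ∀ v ∈ Set.extremePoints ℝ (Metric.closedBall (0 : E) 1),
      0 < planeDet e a v → 0 ≤ planeDet e b v) : ‖a + b‖ = 2 := by
  have : ProperSpace E := FiniteDimensional.proper ℝ E
  -- scaled by `planeDet e a b`, this is the linear functional with value one at `a` and `b`
  set f : E → ℝ := fun v ↦ planeDet e a v - planeDet e b v with hf
  have hfadd : ∀ v w, f (v + w) = f v + f w := by
    intro v w; simp only [hf, planeDet_add_right]; ring
  have hfsmul : ∀ (c : ℝ) v, f (c • v) = c * f v := by
    intro c v; simp only [hf, planeDet_smul_right]; ring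
  have hfcont : Continuous f :=
    (continuous_planeDet_right e a).sub (continuous_planeDet_right e b)
  have hext : ∀ v ∈ Set.extremePoints ℝ (Metric.closedBall (0 : E) 1), f v ≤ planeDet e a b := by
    intro v hv
    by_contra! hlt
    have hv1 : ‖v‖ ≤ 1 := by simpa using hv.1
    have key := planeDet_smul_eq e a b v
    by_cases hav : 0 < planeDet e a v
    · have hbv := h v hv hav
      have h1 : planeDet e a v • b = planeDet e a b • v + planeDet e b v • a := by
        rw [key, planeDet_swap e v b]; module
      have h2 := norm_add_le (planeDet e a b • v) (planeDet e b v • a)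
      rw [← h1, norm_smul, norm_smul, norm_smul, ha, hb, Real.norm_of_nonneg hav.le,
        Real.norm_of_nonneg hbv, Real.norm_of_nonneg hab.le] at h2
      simp only [hf] at hlt
      nlinarith
    · push Not at hav
      have hvb : 0 < planeDet e v b := by
        rw [planeDet_swap]; simp only [hf] at hlt; linarith
      have h1 : planeDet e v b • a = planeDet e a b • v + (-planeDet e a v) • b := by
        rw [key]; module
      have h2 := norm_add_le (planeDet e a b • v) ((-planeDet e a v) • b)
      rw [← h1, norm_smul, norm_smul, norm_smul, ha, hb, Real.norm_of_nonneg hvb.le,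
        Real.norm_of_nonneg (neg_nonneg.2 hav), Real.norm_of_nonneg hab.le] at h2
      simp only [hf] at hlt
      rw [planeDet_swap e b v] at hlt
      nlinarith
  have hball : ∀ v ∈ Metric.closedBall (0 : E) 1, f v ≤ planeDet e a b := by
    have hconv : Convex ℝ {v | f v ≤ planeDet e a b} := by
      intro v hv w hw s t hs ht hst
      simp only [Set.mem_ofPred_eq, hfadd, hfsmul] at hv hw ⊢
      have := mul_le_mul_of_nonneg_left hv hs
      have := mul_le_mul_of_nonneg_left hw ht
      calc s * f v + t * f w ≤ (s + t) * planeDet e a b := by linarith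
        _ = planeDet e a b := by rw [hst, one_mul]
    have hclosed : IsClosed {v | f v ≤ planeDet e a b} := isClosed_le hfcont continuous_const
    have := closure_minimal (convexHull_min (fun v hv ↦ hext v hv) hconv) hclosed
    rw [closure_convexHull_extremePoints (isCompact_closedBall 0 1)
      (convex_closedBall 0 1)] at this
    exact this
  have hle : ‖a + b‖ ≤ 2 := (norm_add_le a b).trans (by rw [ha, hb]; norm_num)
  refine hle.antisymm ?_
  have hfab : f (a + b) = 2 * planeDet e a b := by
    simp only [hf, planeDet_add_right, planeDet_self]
    rw [planeDet_swap e b a]; ring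
  have hpos : 0 < ‖a + b‖ := by
    rw [norm_pos_iff]
    intro h0
    rw [h0] at hfab
    have : f 0 = 0 := by simpa using hfsmul 0 0
    linarith
  have h1 := hball (‖a + b‖⁻¹ • (a + b)) (by
    rw [mem_closedBall_zero_iff, norm_smul, norm_inv, norm_norm, inv_mul_cancel₀ hpos.ne'])
  rw [hfsmul, hfab, inv_mul_le_iff₀ hpos] at h1
  exact le_of_mul_le_mul_right h1 hab

/-- Every nonzero vector lies in the cone spanned by two neighbouring vertices, in the form of
sign conditions on determinants. -/
lemma exists_forall_planeDet_pos (e : E ≃ₗ[ℝ] ℂ) {m : ℕ} (hm : 2 ≤ m) {p : ℤ → E}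
    (hadd : ∀ i, p (i + m) = -p i)
    (hpos : ∀ i j : ℤ, i < j → j < i + m → 0 < planeDet e (p i) (p j)) {x : E} (hx : x ≠ 0) :
    ∃ v : ℤ, ∀ i, v - m < i → i < v → 0 < planeDet e (p i) x := by
  have hex : ∃ i, 0 < planeDet e (p i) x := by
    by_contra! hle
    have hzero : ∀ i, planeDet e (p i) x = 0 := fun i ↦ by
      have := hle (i + m)
      rw [hadd, planeDet_neg_left] at this
      have := hle i
      linarith
    have h01 := hpos 0 1 (by norm_num) (by omega)
    have key := planeDet_smul_eq e (p 0) (p 1) x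
    rw [planeDet_swap e x, hzero, hzero, neg_zero, zero_smul, zero_smul, add_zero] at key
    exact (smul_ne_zero h01.ne' hx) key
  obtain ⟨i₀, hi₀⟩ := hex
  have hexn : ∃ n : ℕ, planeDet e (p (i₀ + n)) x ≤ 0 :=
    ⟨m, by rw [hadd, planeDet_neg_left]; linarith⟩
  classical
  set n := Nat.find hexn with hn
  have hn1 : planeDet e (p (i₀ + n)) x ≤ 0 := Nat.find_spec hexn
  have hn0 : n ≠ 0 := by
    intro h
    rw [h] at hn1
    simp only [Nat.cast_zero, add_zero] at hn1
    linarith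
  have hn2 : 0 < planeDet e (p (i₀ + n - 1)) x := by
    have := Nat.find_min hexn (m := n - 1) (by omega)
    rw [not_le] at this
    rwa [show i₀ + (n : ℤ) - 1 = i₀ + ((n - 1 : ℕ) : ℤ) by omega]
  set v := i₀ + (n : ℤ)
  refine ⟨v, fun i h1 h2 ↦ ?_⟩
  rcases (show i = v - 1 ∨ i < v - 1 by omega) with rfl | h3
  · exact hn2
  · have e1 := hpos (v - m) i h1 (by omega)
    have e2 := hpos i (v - 1) h3 (by omega)
    have e3 := hpos (v - m) (v - 1) (by omega) (by omega)
    have e4 : 0 ≤ planeDet e (p (v - m)) x := by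
      have : p v = -p (v - m) := by rw [← hadd]; congr 1; ring
      rw [this, planeDet_neg_left] at hn1
      linarith
    have key := planeDet_mul_planeDet e (p (v - m)) (p (v - 1)) (p i) x
    have : 0 < planeDet e (p (v - m)) (p (v - 1)) * planeDet e (p i) x := by rw [key]; positivity
    exact (pos_iff_pos_of_mul_pos this).1 e3

end Polygon

/-- A uniform positive lower bound for `k`-fold positivity on a compact set. -/
lemma IsCompact.exists_pos_le_ncard {X ι : Type*} [TopologicalSpace X] [Finite ι] {K : Set X}
    (hK : IsCompact K) (g : ι → X → ℝ) (hg : ∀ i, Continuous (g i)) (k : ℕ)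
    (h : ∀ x ∈ K, k ≤ {i | 0 < g i x}.ncard) :
    ∃ δ > 0, ∀ x ∈ K, k ≤ {i | δ ≤ g i x}.ncard := by
  refine hK.induction_on (p := fun s ↦ ∃ δ > 0, ∀ x ∈ s, k ≤ {i | δ ≤ g i x}.ncard)
    ⟨1, one_pos, by simp⟩ ?_ ?_ ?_
  · rintro s t hst ⟨δ, hδ, H⟩
    exact ⟨δ, hδ, fun x hx ↦ H x (hst hx)⟩
  · rintro s t ⟨δ, hδ, H⟩ ⟨δ', hδ', H'⟩
    refine ⟨min δ δ', lt_min hδ hδ', ?_⟩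
    rintro x (hx | hx)
    · exact (H x hx).trans (Set.ncard_le_ncard fun i (hi : _ ≤ g i x) ↦
          show _ ≤ g i x from (min_le_left _ _).trans hi)
    · exact (H' x hx).trans (Set.ncard_le_ncard fun i (hi : _ ≤ g i x) ↦
          show _ ≤ g i x from (min_le_right _ _).trans hi)
  · intro x hx
    have hδ : ∀ᶠ δ in nhdsWithin (0 : ℝ) (Set.Ioi 0), ∀ i, 0 < g i x → δ < g i x := by
      rw [Filter.eventually_all]
      intro i
      by_cases hi : 0 < g i x
      · filter_upwards [nhdsWithin_le_nhds (Iio_mem_nhds hi)] with δ hδ _ using hδ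
      · exact Filter.Eventually.of_forall fun δ h ↦ absurd h hi
    obtain ⟨δ, hδ, hδ0⟩ := (hδ.and self_mem_nhdsWithin).exists
    have hev : ∀ᶠ y in nhds x, ∀ i, 0 < g i x → δ < g i y := by
      rw [Filter.eventually_all]
      intro i
      by_cases hi : 0 < g i x
      · filter_upwards [(hg i).continuousAt.eventually (lt_mem_nhds (hδ i hi))] with y hy _
          using hy
      · exact Filter.Eventually.of_forall fun δ h ↦ absurd h hi
    exact ⟨_, nhdsWithin_le_nhds hev, δ, hδ0, fun y hy ↦
      (h x hx).trans (Set.ncard_le_ncard fun i hi ↦ (hy i hi).le)⟩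

lemma IsCompact.diam_lt {X : Type*} [PseudoMetricSpace X] {K : Set X} (hK : IsCompact K) {d : ℝ}
    (hd : 0 < d) (h : ∀ x ∈ K, ∀ y ∈ K, dist x y < d) : Metric.diam K < d := by
  rcases K.eq_empty_or_nonempty with rfl | hne
  · simpa using hd
  · obtain ⟨⟨x, y⟩, hxy, hmax⟩ := (hK.prod hK).exists_isMaxOn (hne.prod hne)
      (continuous_dist (α := X)).continuousOn
    refine (Metric.diam_le_of_forall_dist_le dist_nonneg fun a ha b hb ↦ ?_).trans_lt
      (h x hxy.1 y hxy.2)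
    exact hmax (Set.mk_mem_prod ha hb)

/-- The blocks of `q` consecutive integers starting at `j * q + 1`, for `j < N`, cover every
residue class modulo `M` at least `k` times if `M * k ≤ N * q`. -/
lemma le_ncard_blocks {M k N q : ℕ} (hq : 0 < q) (hqM : q ≤ M) (hN : M * k ≤ N * q) {v : ℤ} :
    k ≤ {j : Fin N | ∃ t : ℤ, ((j : ℕ) * q : ℤ) < v + M * t ∧
      v + M * t ≤ (j : ℕ) * q + q}.ncard := by
  have hM : (0 : ℤ) < M := by omega
  set a := ((v - 1) % M).toNat with ha
  have h1 := Int.emod_nonneg (v - 1) hM.ne'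
  have h2 := Int.emod_lt_of_pos (v - 1) hM
  have h3 := Int.emod_add_mul_ediv (v - 1) M
  have haM : a < M := by omega
  have hlt : ∀ t : Fin k, (a + M * t) / q < N := by
    intro t
    rw [Nat.div_lt_iff_lt_mul hq]
    have : M * (t + 1) ≤ M * k := Nat.mul_le_mul_left _ t.2
    rw [mul_add, mul_one] at this
    omega
  set f : Fin k → Fin N := fun t ↦ ⟨(a + M * t) / q, hlt t⟩ with hf
  have hmono : StrictMono f := by
    intro s t hst
    simp only [hf, Fin.mk_lt_mk]
    rw [← Nat.succ_le_iff, Nat.le_div_iff_mul_le hq, Nat.succ_mul]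
    have h4 := Nat.div_mul_le_self (a + M * s) q
    have h5 : M * (s + 1) ≤ M * t := Nat.mul_le_mul_left _ hst
    rw [mul_add, mul_one] at h5
    omega
  calc k = (Set.range f).ncard := by
        rw [← Set.image_univ, Set.ncard_image_of_injective _ hmono.injective, Set.ncard_univ,
          Nat.card_fin]
    _ ≤ _ := by
        refine Set.ncard_le_ncard ?_
        rintro _ ⟨t, rfl⟩
        refine ⟨(t : ℕ) - (v - 1) / M, ?_⟩
        have h6 := Nat.div_add_mod (a + M * t) q
        have h7 := Nat.mod_lt (a + M * t) hq
        have h8 : v + (M : ℤ) * ((t : ℕ) - (v - 1) / M) = ((a + M * t : ℕ) : ℤ) + 1 := by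
          push_cast
          rw [ha, Int.toNat_of_nonneg h1]
          linear_combination -h3
        rw [h8]
        simp only [hf]
        rw [mul_comm] at h6
        constructor <;> norm_cast <;> omega

/-- In a cyclic sequence of length `2 * m`, a set containing no two elements at distance
`m - 1`, `m` or `m + 1` has at most `m - 1` elements. -/
lemma card_filter_range_lt {m : ℕ} (hm : 0 < m) (A : ℕ → Prop) [DecidablePred A]
    (hper : ∀ i, A (i + 2 * m) ↔ A i) (h0 : ∀ i, A i → ¬ A (i + m))
    (h1 : ∀ i, A i → ¬ A (i + m + 1)) :
    ((Finset.range (2 * m)).filter A).card < m := by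
  have hsum : ((Finset.range (2 * m)).filter A).card
      = ∑ i ∈ Finset.range m, ((if A i then 1 else 0) + (if A (i + m) then 1 else 0)) := by
    rw [Finset.card_filter, two_mul, Finset.sum_range_add, Finset.sum_add_distrib]
    simp only [add_comm]
  rw [hsum]
  have hone : ∀ i, ((if A i then 1 else 0) + (if A (i + m) then 1 else 0)) ≤ 1 := by
    intro i
    have := h0 i
    split_ifs <;> simp_all
  have hex : ∃ i < m, ¬ A i ∧ ¬ A (i + m) := by
    by_contra! hall
    have hall' : ∀ i, ¬ A i → A (i + m) := by
      intro i hi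
      have key : ∀ n j, j < m → (¬ A (j + m * n) → A (j + m * n + m)) := by
        intro n
        induction n with
        | zero => intro j hj; simpa using hall j hj
        | succ n ih =>
          intro j hj hA
          rw [mul_add, mul_one, ← add_assoc] at hA ⊢
          have h2 : A (j + m * n) := by
            by_contra hc
            exact hA (ih j hj hc)
          rw [add_assoc, ← two_mul, hper]
          exact h2
      have := key (i / m) (i % m) (Nat.mod_lt i hm)
      rw [Nat.mod_add_div] at this
      exact this hi
    have hstep : ∀ i, A i → A (i + 1) := by
      intro i hi
      by_contra hc
      have := hall' (i + 1) hc
      exact h1 i hi (by rwa [add_right_comm] at this)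
    have hind : ∀ i n, A i → A (i + n) := by
      intro i n hi
      induction n with
      | zero => exact hi
      | succ n ih => exact hstep _ ih
    by_cases hA : A 0
    · exact h0 0 hA (hind 0 m hA)
    · exact h0 _ (hall' 0 hA) (hind _ m (hall' 0 hA))
  obtain ⟨i, hi, hA, hA'⟩ := hex
  calc _ < ∑ i ∈ Finset.range m, 1 :=
        Finset.sum_lt_sum (fun i _ ↦ hone i) ⟨i, Finset.mem_range.2 hi, by simp [hA, hA']⟩
    _ = m := by simp

theorem borsuk_symmetric_polygon {E : Type*} [NormedAddCommGroup E] [NormedSpace ℝ E]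
    (hdim : Module.finrank ℝ E = 2)
    (m : ℕ) (hm : 2 ≤ m)
    -- the unit ball of the norm is a polygon with 2m vertices
    (hfin : (Set.extremePoints ℝ (Metric.closedBall (0 : E) 1)).Finite)
    (hcard : (Set.extremePoints ℝ (Metric.closedBall (0 : E) 1)).ncard = 2 * m)
    (k : ℕ) (hk : 0 < k) :
    borsukNum (Metric.closedBall (0 : E) 1) k
      = ((2 * k + (2 * k + m - 2) / (m - 1) : ℕ) : ℕ∞) := by
  have : FiniteDimensional ℝ E := FiniteDimensional.of_finrank_pos (by omega)
  have : Nontrivial E := Module.nontrivial_of_finrank_pos (R := ℝ) (by omega)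
  have : ProperSpace E := FiniteDimensional.proper ℝ E
  have e : E ≃ₗ[ℝ] ℂ :=
    LinearEquiv.ofFinrankEq E ℂ (by rw [hdim, Complex.finrank_real_complex])
  obtain ⟨p, hrange, hadd, hpos⟩ :=
    exists_enumeration_extremePoints e (by omega) hfin hcard
  have hpext : ∀ i, p i ∈ Set.extremePoints ℝ (Metric.closedBall (0 : E) 1) := fun i ↦
    hrange ▸ Set.mem_range_self i
  have hp1 : ∀ i, ‖p i‖ = 1 := fun i ↦ norm_eq_one_of_mem_extremePoints_closedBall (hpext i)
  have hper : Function.Periodic p ((2 * m : ℕ) : ℤ) := by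
    intro i
    push_cast
    rw [two_mul, ← add_assoc, hadd, hadd, neg_neg]
  have hdiam : Metric.diam (Metric.closedBall (0 : E) 1) = 2 := by
    refine le_antisymm (by simpa using Metric.diam_closedBall (x := (0 : E)) zero_le_one) ?_
    have := Metric.dist_le_diam_of_mem (Metric.isBounded_closedBall (x := (0 : E)) (r := 1))
      (hpext 0).1 (neg_mem_extremePoints_closedBall (hpext 0)).1
    rw [dist_eq_norm, sub_neg_eq_add, ← two_smul ℝ, norm_smul, hp1] at this
    simpa using this
  obtain ⟨q, rfl⟩ : ∃ q, m = q + 1 := ⟨m - 1, by omega⟩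
  have hq : 0 < q := by omega
  rw [show q + 1 - 1 = q by omega, show 2 * k + (q + 1) - 2 = 2 * k + q - 1 by omega]
  refine le_antisymm (sInf_le ⟨_, rfl, ?_⟩) (le_sInf ?_)
  · set N := 2 * k + (2 * k + q - 1) / q with hN
    have hNq : 2 * (q + 1) * k ≤ N * q := by
      have h1 := Nat.lt_mul_div_succ (2 * k + q - 1) hq
      rw [mul_add, mul_one] at h1
      have h3 : N * q = 2 * k * q + q * ((2 * k + q - 1) / q) := by rw [hN]; ring
      have h4 : 2 * k ≤ q * ((2 * k + q - 1) / q) := by omega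
      linarith
    set g : Fin N → E → ℝ := fun j x ↦ max (1 - ‖x‖) (planeDet e (p ((j : ℕ) * q)) x) with hg
    have hgcont : ∀ j, Continuous (g j) := fun j ↦
      (continuous_const.sub continuous_norm).max (continuous_planeDet_right e _)
    have hcover : ∀ x ∈ Metric.closedBall (0 : E) 1, k ≤ {j | 0 < g j x}.ncard := by
      intro x hx
      by_cases hx1 : x = 0
      · have : {j | 0 < g j x} = Set.univ := by
          ext j; simp [hg, hx1]
        rw [this, Set.ncard_univ, Nat.card_fin, hN]
        exact le_add_right (by omega)
      · obtain ⟨v, hv⟩ := exists_forall_planeDet_pos e hm hadd hpos hx1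
        refine (le_ncard_blocks hq (by omega) hNq (v := v)).trans (Set.ncard_le_ncard ?_)
        rintro j ⟨t, ht1, ht2⟩
        have h1 := hv ((j : ℕ) * q - t * ((2 * (q + 1) : ℕ) : ℤ))
          (by push_cast at ht1 ht2 ⊢; linarith) (by push_cast at ht1 ht2 ⊢; linarith)
        rw [← Int.cast_id (n := t), hper.sub_int_mul_eq] at h1
        exact lt_max_of_lt_right h1
    obtain ⟨δ, hδ, hδcover⟩ :=
      (isCompact_closedBall (0 : E) 1).exists_pos_le_ncard g hgcont k hcover
    refine ⟨fun j ↦ {x ∈ Metric.closedBall (0 : E) 1 | δ ≤ g j x}, fun j ↦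
      ⟨fun x hx ↦ hx.1, ?_⟩, fun x hx ↦ (hδcover x hx).trans
        (Set.ncard_le_ncard fun j hj ↦ ⟨hx, hj⟩)⟩
    rw [hdiam]
    refine ((isCompact_closedBall (0 : E) 1).inter_right
      (isClosed_le continuous_const (hgcont j))).diam_lt two_pos ?_
    rintro x ⟨hx, hgx⟩ y ⟨hy, hgy⟩
    rw [mem_closedBall_zero_iff] at hx hy
    have hsub := norm_sub_le x y
    rw [← dist_eq_norm] at hsub
    rcases lt_max_iff.1 (hδ.trans_le hgx) with h1 | h1
    · linarith
    rcases lt_max_iff.1 (hδ.trans_le hgy) with h2 | h2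
    · linarith
    exact dist_lt_two_of_planeDet_pos e (hpext _) hx hy h1 h2
  · rintro _ ⟨n, rfl, F, hF, hFcover⟩
    rw [Nat.cast_le]
    have hedge : ∀ i, ‖p i + p (i + 1)‖ = 2 := by
      intro i
      refine norm_add_eq_two_of_planeDet_pos e (hp1 _) (hp1 _)
        (hpos _ _ (by omega) (by omega)) ?_
      intro v hv hiv
      rw [← hrange] at hv
      obtain ⟨j', rfl⟩ := hv
      obtain ⟨j, ⟨hj1, hj2⟩, hj⟩ := hper.exists_mem_Ico (by positivity) j' i
      rw [hj] at hiv ⊢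
      have hjm : ∀ l, p l = -p (l - (q + 1 : ℕ)) := by
        intro l; rw [← hadd, sub_add_cancel]
      rcases lt_trichotomy j (i + (q + 1 : ℕ)) with h | h | h
      · rcases hj1.eq_or_lt with rfl | h'
        · rw [planeDet_self] at hiv; exact absurd hiv (lt_irrefl _)
        · rcases (show j = i + 1 ∨ i + 1 < j by omega) with rfl | h''
          · rw [planeDet_self]
          · exact (hpos _ _ h'' (by omega)).le
      · rw [h, hadd, planeDet_neg_right, planeDet_self, neg_zero] at hiv
        exact absurd hiv (lt_irrefl _)
      · have := hpos i (j - (q + 1 : ℕ)) (by omega) (by push_cast at hj2 ⊢; omega)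
        rw [hjm j, planeDet_neg_right] at hiv
        linarith
    have hfar : ∀ a x y, x ∈ F a → y ∈ F a → dist x y < 2 := by
      intro a x y hx hy
      have h1 := Metric.dist_le_diam_of_mem
        (Metric.isBounded_closedBall.subset (hF a).1) hx hy
      have h2 := (hF a).2
      rw [hdiam] at h2
      linarith
    classical
    have hsmall : ∀ a, ((Finset.range (2 * (q + 1))).filter
        (fun i : ℕ ↦ p i ∈ F a)).card ≤ q := by
      intro a
      refine Nat.lt_succ_iff.1 (card_filter_range_lt (by omega) _ ?_ ?_ ?_)
      · intro i
        rw [Nat.cast_add, hper]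
      · intro i h1 h2
        have := hfar a _ _ h1 h2
        rw [Nat.cast_add, hadd, dist_eq_norm, sub_neg_eq_add, ← two_smul ℝ, norm_smul, hp1]
          at this
        norm_num at this
      · intro i h1 h2
        have := hfar a _ _ h1 h2
        rw [Nat.cast_add, Nat.cast_add, add_right_comm, hadd, dist_eq_norm, sub_neg_eq_add,
          Nat.cast_one, hedge] at this
        exact lt_irrefl _ this
    have hcount : 2 * (q + 1) * k ≤ n * q := by
      calc 2 * (q + 1) * k = ∑ i ∈ Finset.range (2 * (q + 1)), k := by simp
        _ ≤ ∑ i ∈ Finset.range (2 * (q + 1)),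
              ((Finset.univ : Finset (Fin n)).filter (fun a ↦ p (i : ℕ) ∈ F a)).card := by
            refine Finset.sum_le_sum fun i _ ↦ (hFcover _ (hpext i).1).trans_eq ?_
            rw [← Set.ncard_coe_finset]
            simp
        _ = ∑ a : Fin n, ((Finset.range (2 * (q + 1))).filter
              (fun i : ℕ ↦ p i ∈ F a)).card :=
            Finset.sum_card_bipartiteAbove_eq_sum_card_bipartiteBelow
              (fun (i : ℕ) (a : Fin n) ↦ p i ∈ F a)
        _ ≤ ∑ a : Fin n, q := Finset.sum_le_sum fun a _ ↦ hsmall a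
        _ = n * q := by simp
    have h2k : 2 * k ≤ n := by
      by_contra! hlt
      have h1 : n * q ≤ 2 * k * q := Nat.mul_le_mul_right _ hlt.le
      linarith
    obtain ⟨d, rfl⟩ := Nat.exists_eq_add_of_le h2k
    have hdq : 2 * k ≤ d * q := by linarith
    refine Nat.add_le_add_left (Nat.lt_succ_iff.1 ?_) _
    rw [Nat.div_lt_iff_lt_mul hq, Nat.succ_mul d]
    omega
end
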